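/- arXiv:2009.11176 — 2 statements merged into one kernel-verified Lean document; each statement's English description precedes it below -/
import Mathlib

section
/- (Lemma A.2, level repulsion for the conditioned measure.) For every β ≥ 1 there exist C > 0 and ξ₀ > 0 such that for all 0 < ξ ≤ ξ₀, all integers N ≥ 2, all integers 1 ≤ K ≤ N^{1/2}, every boundary vector y ∈ R_K(ξ), and all s > 0, the conditional measure satisfies P^{μ_y}[y_{K+1} − x_K ≤ s K^{−1/3}] ≤ C s^{β+1} (K² + K N^{Cξ})^{β+1}. -/
open MeasureTheory Real
open scoped ENNReal

/-- The semicircle density. -/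
noncomputable def semicircle (E : ℝ) : ℝ :=
  if |E| ≤ 2 then Real.sqrt (4 - E ^ 2) / (2 * Real.pi) else 0

/-- The external potential `V_y` felt by the first `K` particles given the boundary
configuration `y` (whose relevant coordinates are `y_{K+1}, …, y_N`). -/
noncomputable def Vy (N K : ℕ) (y : ℕ → ℝ) (t : ℝ) : ℝ :=
  ((N : ℝ) ^ (-(2 : ℝ) / 3) * t) ^ 2 / 2
    - (2 / (N : ℝ)) * ∑ j ∈ Finset.Icc (K + 1) N, Real.log |t - y j|

/-- The conditional Hamiltonian `H_y`. -/
noncomputable def Hy (N K : ℕ) (y : ℕ → ℝ) (x : Fin K → ℝ) : ℝ :=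
  (1 / 2) * ∑ i, Vy N K y (x i)
    - (1 / (N : ℝ)) * ∑ i : Fin K, ∑ j : Fin K, if i < j then Real.log (x j - x i) else 0

open Classical in
/-- Unnormalized density of the conditional measure `μ_y`, supported on
`{x : x_1 < ⋯ < x_K < y_{K+1}}`. -/
noncomputable def condDensity (β : ℝ) (N K : ℕ) (y : ℕ → ℝ) (x : Fin K → ℝ) : ℝ :=
  if (∀ i j : Fin K, i < j → x i < x j) ∧ ∀ i : Fin K, x i < y (K + 1) then
    Real.exp (-(β * (N : ℝ)) * Hy N K y x)
  else 0

section ProductMaps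

open Set

theorem AntilipschitzWith.volume_preimage_le {k : NNReal} {φ : ℝ → ℝ}
    (hφ : AntilipschitzWith k φ) (s : Set ℝ) : volume (φ ⁻¹' s) ≤ k * volume s := by
  have h := hφ.hausdorffMeasure_preimage_le (d := 1) zero_le_one s
  simpa [hausdorffMeasure_real] using h

variable {ι : Type*} [Fintype ι] {k : ι → NNReal} {φ : ι → ℝ → ℝ}

theorem map_piMap_volume_le (hk : ∀ i, k i ≠ 0) (hφ : ∀ i, AntilipschitzWith (k i) (φ i))
    (hm : ∀ i, Measurable (φ i)) :
    Measure.map (fun (x : ι → ℝ) i => φ i (x i)) volume ≤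
      (∏ i, (k i : ℝ≥0∞)) • (volume : Measure (ι → ℝ)) := by
  set S : (ι → ℝ) → ι → ℝ := fun x i => φ i (x i) with hS
  have hSm : Measurable S := measurable_pi_lambda _ fun i => (hm i).comp (measurable_pi_apply i)
  set c : ℝ≥0∞ := ∏ i, (k i : ℝ≥0∞) with hc
  have hc0 : c ≠ 0 := by simpa [hc, Finset.prod_eq_zero_iff] using hk
  have hctop : c ≠ ⊤ := ENNReal.prod_ne_top fun i _ => ENNReal.coe_ne_top
  have key : c⁻¹ • OuterMeasure.map S (volume : Measure (ι → ℝ)).toOuterMeasure ≤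
      OuterMeasure.pi fun _ : ι => (volume : Measure ℝ).toOuterMeasure := by
    rw [OuterMeasure.le_pi]
    intro s _
    have hpre : S ⁻¹' univ.pi s = univ.pi fun i => φ i ⁻¹' s i := by
      ext x; simp [hS, mem_pi]
    simp only [smul_apply, OuterMeasure.map_apply, hpre, smul_eq_mul,
      Measure.coe_toOuterMeasure, volume_pi_pi]
    rw [mul_comm, ← div_eq_mul_inv]
    refine ENNReal.div_le_of_le_mul' ?_
    rw [hc, ← Finset.prod_mul_distrib]
    exact Finset.prod_le_prod' fun i _ => (hφ i).volume_preimage_le _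
  refine Measure.le_iff.2 fun A hA => ?_
  have hvol : (volume : Measure (ι → ℝ)) A =
      OuterMeasure.pi (fun _ : ι => (volume : Measure ℝ).toOuterMeasure) A := by
    rw [volume_pi, Measure.pi, toMeasure_apply _ _ hA]
  rw [Measure.map_apply hSm hA, Measure.smul_apply, smul_eq_mul, hvol]
  have h := key A
  simp only [smul_apply, OuterMeasure.map_apply, smul_eq_mul,
    Measure.coe_toOuterMeasure] at h
  rwa [mul_comm, ← div_eq_mul_inv, ENNReal.div_le_iff hc0 hctop, mul_comm] at h

end ProductMaps

section SemicircleQuantiles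

theorem semicircle_eq_sqrt (E : ℝ) : semicircle E = √(4 - E ^ 2) / (2 * π) := by
  unfold semicircle
  split_ifs with h
  · rfl
  · have : 4 - E ^ 2 ≤ 0 := by
      have h2 : 2 < |E| := not_le.1 h
      nlinarith [sq_abs E]
    rw [Real.sqrt_eq_zero_of_nonpos this, zero_div]

theorem semicircle_eq_zero {E : ℝ} (h : 2 ≤ |E|) : semicircle E = 0 := by
  have : 4 - E ^ 2 ≤ 0 := by nlinarith [sq_abs E]
  rw [semicircle_eq_sqrt, Real.sqrt_eq_zero_of_nonpos this, zero_div]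

theorem continuous_semicircle : Continuous semicircle := by
  have : semicircle = fun E => √(4 - E ^ 2) / (2 * π) := funext semicircle_eq_sqrt
  rw [this]
  fun_prop

theorem integral_semicircle_neg_two_cos {θ : ℝ} (h0 : 0 ≤ θ) (hπ : θ ≤ π) :
    ∫ E in (-2 : ℝ)..(-2 * cos θ), semicircle E = (θ - sin θ * cos θ) / π := by
  have h := intervalIntegral.integral_comp_mul_deriv (a := 0) (b := θ)
    (f := fun t => -2 * cos t) (f' := fun t => 2 * sin t) (g := semicircle)
    (fun t _ => by simpa using (hasDerivAt_cos t).const_mul (-2))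
    (by fun_prop) continuous_semicircle
  simp only [cos_zero, mul_one] at h
  rw [← h]
  have hcongr : ∀ t ∈ Set.uIcc 0 θ,
      (semicircle ∘ fun t => -2 * cos t) t * (2 * sin t) = 2 / π * sin t ^ 2 := by
    intro t ht
    rw [Set.uIcc_of_le h0] at ht
    have hs : 0 ≤ sin t := sin_nonneg_of_nonneg_of_le_pi ht.1 (ht.2.trans hπ)
    have : 4 - (-2 * cos t) ^ 2 = (2 * sin t) ^ 2 := by nlinarith [sin_sq_add_cos_sq t]
    rw [Function.comp_apply, semicircle_eq_sqrt, this, Real.sqrt_sq (by positivity)]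
    field_simp
  rw [intervalIntegral.integral_congr hcongr, intervalIntegral.integral_const_mul,
    integral_sin_sq]
  simp
  field_simp
  ring

theorem integral_semicircle_of_two_le {g : ℝ} (h : 2 ≤ g) :
    ∫ E in (-2 : ℝ)..g, semicircle E = 1 := by
  rw [← intervalIntegral.integral_add_adjacent_intervals
    (continuous_semicircle.intervalIntegrable _ 2) (continuous_semicircle.intervalIntegrable _ _)]
  have h1 := integral_semicircle_neg_two_cos pi_nonneg le_rfl
  have h2 : ∫ E in (2 : ℝ)..g, semicircle E = ∫ E in (2 : ℝ)..g, (0 : ℝ) :=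
    intervalIntegral.integral_congr fun E hE => by
      rw [Set.uIcc_of_le h] at hE
      exact semicircle_eq_zero (hE.1.trans (le_abs_self E))
  simp at h1 h2
  rw [h1, h2]
  simp

theorem integral_semicircle_of_le_neg_two {g : ℝ} (h : g ≤ -2) :
    ∫ E in (-2 : ℝ)..g, semicircle E = 0 := by
  have h2 : ∫ E in (-2 : ℝ)..g, semicircle E = ∫ E in (-2 : ℝ)..g, (0 : ℝ) :=
    intervalIntegral.integral_congr fun E hE => by
      rw [Set.uIcc_of_ge h] at hE
      exact semicircle_eq_zero (by rw [le_abs]; right; linarith [hE.2])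
  simpa using h2

theorem hasDerivAt_sub_sin_mul_cos (θ : ℝ) :
    HasDerivAt (fun t => t - sin t * cos t) (2 * sin θ ^ 2) θ := by
  have := (hasDerivAt_id θ).sub ((hasDerivAt_sin θ).mul (hasDerivAt_cos θ))
  convert! this using 1
  nlinarith [sin_sq_add_cos_sq θ]

theorem monotone_sub_sin_mul_cos : Monotone fun t : ℝ => t - sin t * cos t :=
  monotone_of_deriv_nonneg (fun t => (hasDerivAt_sub_sin_mul_cos t).differentiableAt)
    fun t => by rw [(hasDerivAt_sub_sin_mul_cos t).deriv]; positivity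

theorem sub_sin_mul_cos_le_cube {θ : ℝ} (h : 0 ≤ θ) : θ - sin θ * cos θ ≤ 2 * θ ^ 3 / 3 := by
  have hd : ∀ t : ℝ, HasDerivAt (fun t => 2 * t ^ 3 / 3 - (t - sin t * cos t))
      (2 * t ^ 2 - 2 * sin t ^ 2) t := fun t => by
    have := (((hasDerivAt_pow 3 t).const_mul 2).div_const 3).sub (hasDerivAt_sub_sin_mul_cos t)
    convert! this using 1
    ring
  have hm : Monotone fun t : ℝ => 2 * t ^ 3 / 3 - (t - sin t * cos t) :=
    monotone_of_deriv_nonneg (fun t => (hd t).differentiableAt) fun t => by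
      rw [(hd t).deriv]
      have := sq_le_sq.2 (abs_sin_le_abs (x := t))
      linarith
  have := hm h
  simp at this
  linarith

theorem cube_le_sub_sin_mul_cos {θ : ℝ} (h0 : 0 ≤ θ) (hπ : θ ≤ π) :
    (θ + sin θ) ^ 3 ≤ 80 * (θ - sin θ * cos θ) := by
  have hs := sin_nonneg_of_nonneg_of_le_pi h0 hπ
  have hsθ := sin_le h0
  have hc : cos θ ≤ 1 - 2 / π ^ 2 * θ ^ 2 :=
    cos_le_one_sub_mul_cos_sq (by rwa [abs_of_nonneg h0])
  have hF : θ * (1 - cos θ) / 2 ≤ θ - sin θ * cos θ := by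
    rcases le_total 0 (cos θ) with h | h
    · nlinarith [mul_le_mul_of_nonneg_right hsθ h, cos_le_one θ, mul_nonneg h0 h]
    · nlinarith [neg_one_le_cos θ, mul_nonneg h0 (neg_nonneg.2 h), mul_nonneg hs (neg_nonneg.2 h)]
  have hπ2 : π ^ 2 ≤ 10 := by nlinarith [pi_lt_d2, pi_pos]
  have h10 : θ ^ 2 / 10 ≤ θ ^ 2 / π ^ 2 := by gcongr
  have h3 : θ ^ 3 / 10 ≤ θ - sin θ * cos θ := by
    have : θ ^ 2 / 10 ≤ (1 - cos θ) / 2 := by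
      have : 2 / π ^ 2 * θ ^ 2 = 2 * (θ ^ 2 / π ^ 2) := by ring
      linarith
    nlinarith [mul_le_mul_of_nonneg_left this h0]
  have : (θ + sin θ) ^ 3 ≤ (2 * θ) ^ 3 := by gcongr; linarith
  nlinarith

theorem sub_le_div_of_quantile {a b : ℝ} (ha : 0 < a) (hab : a ≤ b) (hb : b ≤ π) :
    (b + sin b) - (a + sin a) ≤
      ((b - sin b * cos b) - (a - sin a * cos a)) / (2 * (1 - cos a)) := by
  have hca : cos a < 1 := by
    have := cos_lt_cos_of_nonneg_of_le_pi le_rfl (hab.trans hb) ha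
    rwa [cos_zero] at this
  have hpos : 0 < 2 * (1 - cos a) := by linarith
  have hd : ∀ t : ℝ, HasDerivAt (fun t => (t - sin t * cos t) / (2 * (1 - cos a)) - (t + sin t))
      (2 * sin t ^ 2 / (2 * (1 - cos a)) - (1 + cos t)) t := fun t =>
    ((hasDerivAt_sub_sin_mul_cos t).div_const _).sub ((hasDerivAt_id t).add (hasDerivAt_sin t))
  have hm : MonotoneOn (fun t => (t - sin t * cos t) / (2 * (1 - cos a)) - (t + sin t))
      (Set.Icc a π) := by
    refine monotoneOn_of_deriv_nonneg (convex_Icc _ _)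
      (fun t _ => (hd t).continuousAt.continuousWithinAt)
      (fun t _ => (hd t).differentiableAt.differentiableWithinAt) fun t ht => ?_
    rw [interior_Icc] at ht
    rw [(hd t).deriv, sub_nonneg, le_div_iff₀ hpos]
    have h1 : cos t ≤ cos a := cos_le_cos_of_nonneg_of_le_pi ha.le ht.2.le ht.1.le
    nlinarith [sin_sq_add_cos_sq t, neg_one_le_cos t]
  have := hm ⟨le_rfl, hab.trans hb⟩ ⟨hab, hb⟩ hab
  simp only at this
  rw [sub_div]
  linarith

end SemicircleQuantiles

section EdgeForce

variable {N : ℕ} {γ : ℕ → ℝ}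

theorem neg_two_lt_of_quantile {k : ℕ} (hk : 1 ≤ k) (hkN : k ≤ N)
    (hγ : (k : ℝ) / N = ∫ E in (-2 : ℝ)..(γ k), semicircle E) : -2 < γ k := by
  by_contra! h
  rw [integral_semicircle_of_le_neg_two h] at hγ
  have h1 : (0 : ℝ) < k := by exact_mod_cast hk
  have h2 : (0 : ℝ) < N := by exact_mod_cast hk.trans hkN
  exact absurd hγ (div_pos h1 h2).ne'

theorem exists_quantile_angles
    (hγ : ∀ k : ℕ, 1 ≤ k → k ≤ N → (k : ℝ) / N = ∫ E in (-2 : ℝ)..(γ k), semicircle E) :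
    ∃ θ : ℕ → ℝ, (∀ j, 0 ≤ θ j ∧ θ j ≤ π) ∧ (∀ j, N ≤ j → θ j = π) ∧
      (∀ j, 1 ≤ j → j ≤ N → θ j - sin (θ j) * cos (θ j) = π * (j / N)) ∧
      ∀ j, 1 ≤ j → j < N → γ j = -2 * cos (θ j) := by
  classical
  refine ⟨fun j => if j < N then arccos (-(γ j / 2)) else π, fun j => ?_, fun j hj => ?_,
    fun j hj hjN => ?_, fun j hj hjN => ?_⟩
  · dsimp only
    split_ifs
    · exact ⟨arccos_nonneg _, arccos_le_pi _⟩
    · exact ⟨pi_nonneg, le_rfl⟩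
  · simp [not_lt.2 hj]
  all_goals
    have hN : (0 : ℝ) < N := by
      have : 1 ≤ N := by omega
      exact_mod_cast this
  · rcases hjN.lt_or_eq with hlt | rfl
    · have h1 := neg_two_lt_of_quantile hj hjN (hγ j hj hjN)
      have h2 : γ j < 2 := by
        by_contra! h
        have := hγ j hj hjN
        rw [integral_semicircle_of_two_le h, div_eq_one_iff_eq hN.ne'] at this
        exact hlt.ne (by exact_mod_cast this)
      have hc : cos (arccos (-(γ j / 2))) = -(γ j / 2) :=
        cos_arccos (by linarith) (by linarith)
      have h3 := integral_semicircle_neg_two_cos (arccos_nonneg (-(γ j / 2))) (arccos_le_pi _)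
      have h4 : -2 * -(γ j / 2) = γ j := by ring
      simp only [hlt, if_true]
      rw [hc, h4, ← hγ j hj hjN, eq_div_iff pi_ne_zero] at h3
      rw [hc]
      linarith
    · simp [hN.ne']
  · have h1 := neg_two_lt_of_quantile hj hjN.le (hγ j hj hjN.le)
    have h2 : γ j < 2 := by
      by_contra! h
      have := hγ j hj hjN.le
      rw [integral_semicircle_of_two_le h, div_eq_one_iff_eq hN.ne'] at this
      exact hjN.ne (by exact_mod_cast this)
    simp only [hjN, if_true]
    rw [cos_arccos (by linarith) (by linarith)]
    ring

theorem one_sub_le_sum_inv_quantile (hN : 1 ≤ N) {θ : ℕ → ℝ} (hθ : ∀ j, 0 ≤ θ j ∧ θ j ≤ π)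
    (hπ : ∀ j, N ≤ j → θ j = π)
    (hF : ∀ j, 1 ≤ j → j ≤ N → θ j - sin (θ j) * cos (θ j) = π * (j / N))
    {m : ℕ} (hm : 1 ≤ m) :
    1 - (θ m + sin (θ m)) / π ≤
      ∑ j ∈ Finset.Ico m N, 1 / (N * (2 * (1 - cos (θ j)))) := by
  have hN0 : (0 : ℝ) < N := by exact_mod_cast hN
  rcases le_total N m with h | h
  · simp [hπ m h, Finset.Ico_eq_empty_of_le h]
  · have hstep : ∀ j ∈ Finset.Ico m N,
        (θ (j + 1) + sin (θ (j + 1))) / π - (θ j + sin (θ j)) / π ≤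
          1 / (N * (2 * (1 - cos (θ j)))) := by
      intro j hj
      rw [Finset.mem_Ico] at hj
      have hj1 : 1 ≤ j := hm.trans hj.1
      have e1 := hF j hj1 hj.2.le
      have e2 := hF (j + 1) (by omega) hj.2
      push_cast at e2
      have hpos : 0 < θ j := by
        rcases (hθ j).1.lt_or_eq with h0 | h0
        · exact h0
        · rw [← h0] at e1
          have : (0 : ℝ) < j := by exact_mod_cast hj1
          have : 0 < π * ((j : ℝ) / N) := by positivity
          simp only [sin_zero, zero_mul, sub_zero] at e1
          linarith
      have hle : θ j ≤ θ (j + 1) := by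
        by_contra! hlt
        have := monotone_sub_sin_mul_cos hlt.le
        simp only [e1, e2] at this
        have h5 : (j : ℝ) / N < (j + 1) / N := by gcongr; linarith
        nlinarith [pi_pos]
      have := sub_le_div_of_quantile hpos hle (hθ _).2
      rw [e1, e2] at this
      rw [← sub_div, div_le_iff₀ pi_pos]
      refine this.trans_eq ?_
      field_simp
      ring
    have := Finset.sum_le_sum hstep
    rw [Finset.sum_Ico_sub (fun j => (θ j + sin (θ j)) / π) h] at this
    rw [hπ N le_rfl] at this
    simpa using this

theorem inv_sub_le_inv_add {A δ : ℝ} (hA : 0 < A) (hδ : 0 ≤ δ) :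
    1 / A - δ * (1 / A ^ 2) ≤ 1 / (A + δ) := by
  rw [le_div_iff₀ (by positivity)]
  have : (1 / A - δ * (1 / A ^ 2)) * (A + δ) = 1 - (δ / A) ^ 2 := by field_simp; ring
  rw [this]
  nlinarith [sq_nonneg (δ / A)]

/-- The net force on a particle within unit distance of the boundary particle: the confining
potential is balanced by the outer particles up to `K + N ^ ξ`. -/
theorem exists_edge_force_bound :
    ∃ C : ℝ, 0 ≤ C ∧ ∀ ξ : ℝ, 0 < ξ → ∀ N K : ℕ, 1 ≤ K → K < N → ∀ γ : ℕ → ℝ,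
      (∀ k : ℕ, 1 ≤ k → k ≤ N → (k : ℝ) / N = ∫ E in (-2 : ℝ)..(γ k), semicircle E) →
      ∀ y : ℕ → ℝ,
        (∀ j k : ℕ, K + 1 ≤ j → j < k → k ≤ N → y j < y k) →
        (∀ k : ℕ, K + 1 ≤ k → k ≤ N →
          |y k - (N : ℝ) ^ ((2 : ℝ) / 3) * γ k| ≤
            (N : ℝ) ^ ξ * ((min k (N + 1 - k) : ℕ) : ℝ) ^ (-(1 : ℝ) / 3)) →
      -(C * (K + (N : ℝ) ^ ξ)) ≤ (N : ℝ) ^ (-(1 : ℝ) / 3) * (y (K + 1) - 1) / 2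
        + ∑ j ∈ Finset.Icc (K + 2) N, 1 / (y j - y (K + 1) + 1) := by
  have hsum : Summable fun n : ℕ => ((n : ℝ) ^ ((4 : ℝ) / 3))⁻¹ :=
    Real.summable_nat_rpow_inv.2 (by norm_num)
  set T : ℝ := ∑' n : ℕ, ((n : ℝ) ^ ((4 : ℝ) / 3))⁻¹ with hT
  have hT0 : 0 ≤ T := tsum_nonneg fun n => by positivity
  refine ⟨11 + 48 * T, by positivity, fun ξ hξ N K hK hKN γ hγ y hy hrig => ?_⟩
  have hN1 : (1 : ℝ) ≤ N := by
    have : 1 ≤ N := by omega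
    exact_mod_cast this
  have hN0 : (0 : ℝ) < N := by linarith
  have hK1 : (1 : ℝ) ≤ K := by exact_mod_cast hK
  obtain ⟨θ, hθ, hπ, hF, hcos⟩ := exists_quantile_angles hγ
  set X := (N : ℝ) ^ ξ with hX
  have hX1 : 1 ≤ X := Real.one_le_rpow hN1 hξ.le
  set n : ℝ := (N : ℝ) ^ ((1 : ℝ) / 3) with hn
  have hn1 : 1 ≤ n := Real.one_le_rpow hN1 (by norm_num)
  have hn3 : n ^ 3 = N := by
    rw [hn, ← Real.rpow_natCast, ← Real.rpow_mul hN0.le]; norm_num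
  have hn2 : (N : ℝ) ^ ((2 : ℝ) / 3) = n ^ 2 := by
    rw [hn, ← Real.rpow_natCast, ← Real.rpow_mul hN0.le]; norm_num
  have hninv : (N : ℝ) ^ (-(1 : ℝ) / 3) = n⁻¹ := by
    rw [hn, ← Real.rpow_neg hN0.le]; norm_num
  have hrig' : ∀ k, K + 1 ≤ k → k ≤ N → |y k - n ^ 2 * γ k| ≤ X := by
    intro k h1 h2
    have h3 : (1 : ℝ) ≤ ((min k (N + 1 - k) : ℕ) : ℝ) := by
      have : 1 ≤ min k (N + 1 - k) := by omega
      exact_mod_cast this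
    have := hrig k h1 h2
    rw [hn2] at this
    refine this.trans (mul_le_of_le_one_right (by linarith) ?_)
    exact Real.rpow_le_one_of_one_le_of_nonpos h3 (by norm_num)
  set b := y (K + 1) with hb
  have hb_ge : -2 * n ^ 2 - X ≤ b := by
    have h1 := (abs_le.1 (hrig' (K + 1) le_rfl hKN)).1
    have h2 := neg_two_lt_of_quantile (by omega) hKN (hγ (K + 1) (by omega) hKN)
    nlinarith [mul_le_mul_of_nonneg_left h2.le (sq_nonneg n)]
  have hconf : -n - X ≤ n⁻¹ * (b - 1) / 2 := by
    have h0 : 0 < n⁻¹ := by positivity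
    have h1 : n⁻¹ ≤ 1 := inv_le_one_of_one_le₀ hn1
    have h2 : n⁻¹ * (-2 * n ^ 2 - X - 1) ≤ n⁻¹ * (b - 1) := by gcongr
    have h3 : n⁻¹ * (-2 * n ^ 2 - X - 1) = -2 * n - n⁻¹ * (X + 1) := by field_simp; ring
    nlinarith
  set A : ℕ → ℝ := fun j => n ^ 2 * (2 * (1 - cos (θ j))) with hA
  have hA_ge : ∀ j ∈ Finset.Ico (K + 2) N, (j : ℝ) ^ ((2 : ℝ) / 3) / 4 ≤ A j := by
    intro j hj
    rw [Finset.mem_Ico] at hj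
    have h1 := hF j (by omega) hj.2.le
    have h2 := sub_sin_mul_cos_le_cube (hθ j).1
    have h3 : cos (θ j) ≤ 1 - 2 / π ^ 2 * θ j ^ 2 :=
      cos_le_one_sub_mul_cos_sq (by rw [abs_of_nonneg (hθ j).1]; exact (hθ j).2)
    have hπ2 : π ^ 2 ≤ 10 := by nlinarith [pi_lt_d2, pi_pos]
    have h10 : θ j ^ 2 / 10 ≤ θ j ^ 2 / π ^ 2 := by gcongr
    have h4 : 2 / π ^ 2 * θ j ^ 2 = 2 * (θ j ^ 2 / π ^ 2) := by ring
    have hj0 : (0 : ℝ) ≤ (j : ℝ) / N := by positivity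
    have h5 : (j : ℝ) ≤ (n * θ j) ^ 3 := by
      have : (j : ℝ) / N ≤ θ j ^ 3 := by nlinarith [pi_gt_three]
      rw [div_le_iff₀ hN0] at this
      rw [mul_pow, hn3]; linarith
    have h6 : (j : ℝ) ^ ((2 : ℝ) / 3) ≤ (n * θ j) ^ 2 := by
      have h0 : 0 ≤ n * θ j := mul_nonneg (by linarith) (hθ j).1
      calc (j : ℝ) ^ ((2 : ℝ) / 3) ≤ ((n * θ j) ^ 3) ^ ((2 : ℝ) / 3) := by gcongr
        _ = (n * θ j) ^ 2 := by
          rw [← Real.rpow_natCast, ← Real.rpow_mul h0, ← Real.rpow_natCast]; norm_num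
    have h7 : n ^ 2 * (θ j ^ 2 / 10) ≤ n ^ 2 * ((1 - cos (θ j)) / 2) :=
      mul_le_mul_of_nonneg_left (by linarith) (sq_nonneg n)
    rw [mul_pow] at h6
    simp only [hA]
    have : 0 ≤ n ^ 2 * θ j ^ 2 := by positivity
    linarith
  have hA_pos : ∀ j ∈ Finset.Ico (K + 2) N, 0 < A j := fun j hj => by
    have hj0 : (0 : ℝ) < j := by
      rw [Finset.mem_Ico] at hj
      have : 0 < j := by omega
      exact_mod_cast this
    exact lt_of_lt_of_le (by positivity) (hA_ge j hj)
  have hterm : ∀ j ∈ Finset.Ico (K + 2) N,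
      1 / A j - 3 * X * (16 * ((j : ℝ) ^ ((4 : ℝ) / 3))⁻¹) ≤ 1 / (y j - b + 1) := by
    intro j hj
    have hAj := hA_ge j hj
    have hAp := hA_pos j hj
    rw [Finset.mem_Ico] at hj
    have hj0 : (0 : ℝ) < j := by
      have : 0 < j := by omega
      exact_mod_cast this
    have h1 := (abs_le.1 (hrig' j (by omega) hj.2.le)).2
    have h2 := hcos j (by omega) hj.2
    have h3 : y j - b + 1 ≤ A j + 3 * X := by
      rw [h2] at h1
      simp only [hA]
      linarith
    have h4 : b < y j := hy (K + 1) j le_rfl (by omega) hj.2.le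
    have h5 : 1 / (A j + 3 * X) ≤ 1 / (y j - b + 1) :=
      one_div_le_one_div_of_le (by linarith) h3
    have h6 := inv_sub_le_inv_add hAp (δ := 3 * X) (by linarith)
    have h7 : 1 / A j ^ 2 ≤ 16 * ((j : ℝ) ^ ((4 : ℝ) / 3))⁻¹ := by
      have e : (j : ℝ) ^ ((4 : ℝ) / 3) = ((j : ℝ) ^ ((2 : ℝ) / 3)) ^ 2 := by
        rw [← Real.rpow_natCast, ← Real.rpow_mul hj0.le]; norm_num
      calc 1 / A j ^ 2 ≤ 1 / ((j : ℝ) ^ ((2 : ℝ) / 3) / 4) ^ 2 := by gcongr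
        _ = 16 * ((j : ℝ) ^ ((4 : ℝ) / 3))⁻¹ := by rw [e]; field_simp; norm_num
    have h8 : 3 * X * (1 / A j ^ 2) ≤ 3 * X * (16 * ((j : ℝ) ^ ((4 : ℝ) / 3))⁻¹) := by gcongr
    linarith
  have hsum1 : ∑ j ∈ Finset.Ico (K + 2) N, 1 / (y j - b + 1) ≤
      ∑ j ∈ Finset.Icc (K + 2) N, 1 / (y j - b + 1) := by
    refine Finset.sum_le_sum_of_subset_of_nonneg Finset.Ico_subset_Icc_self fun j hj _ => ?_
    rw [Finset.mem_Icc] at hj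
    have h4 : b < y j := hy (K + 1) j le_rfl (by omega) hj.2
    exact one_div_nonneg.2 (by linarith)
  have hsum2 := Finset.sum_le_sum hterm
  rw [Finset.sum_sub_distrib, ← Finset.mul_sum, ← Finset.mul_sum] at hsum2
  have hsum3 : ∑ j ∈ Finset.Ico (K + 2) N, ((j : ℝ) ^ ((4 : ℝ) / 3))⁻¹ ≤ T :=
    hsum.sum_le_tsum _ fun j _ => by positivity
  have hsum4 : 3 * X * (16 * ∑ j ∈ Finset.Ico (K + 2) N, ((j : ℝ) ^ ((4 : ℝ) / 3))⁻¹) ≤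
      3 * X * (16 * T) := by gcongr
  set G := θ (K + 2) + sin (θ (K + 2)) with hG
  have hG0 : 0 ≤ G :=
    add_nonneg (hθ _).1 (sin_nonneg_of_nonneg_of_le_pi (hθ _).1 (hθ _).2)
  have hmain : n * (1 - G / π) ≤ ∑ j ∈ Finset.Ico (K + 2) N, 1 / A j := by
    have h1 := one_sub_le_sum_inv_quantile (N := N) (by omega) hθ hπ hF (m := K + 2) (by omega)
    have h2 := mul_le_mul_of_nonneg_left h1 (by linarith : 0 ≤ n)
    refine h2.trans_eq ?_
    rw [Finset.mul_sum]
    refine Finset.sum_congr rfl fun j hj => ?_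
    have hAp := hA_pos j hj
    simp only [hA] at hAp ⊢
    have : 1 - cos (θ j) ≠ 0 := fun h0 => by simp [h0] at hAp
    rw [← hn3]
    field_simp
  have hGK : n * (G / π) ≤ 10 * K := by
    have h1 := cube_le_sub_sin_mul_cos (hθ (K + 2)).1 (hθ (K + 2)).2
    have h2 : θ (K + 2) - sin (θ (K + 2)) * cos (θ (K + 2)) ≤ π * ((K + 2) / N) := by
      rcases le_total (K + 2) N with h | h
      · have := hF (K + 2) (by omega) h
        push_cast at this
        exact this.le
      · rw [hπ _ h]
        have h3 : (1 : ℝ) ≤ (K + 2) / N := by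
          rw [le_div_iff₀ hN0, one_mul]
          exact_mod_cast h
        simp only [sin_pi, zero_mul, sub_zero]
        exact le_mul_of_one_le_right pi_nonneg h3
    have h3 : (n * G) ^ 3 ≤ (10 * K) ^ 3 := by
      have e : (N : ℝ) * (π * ((K + 2) / N)) = π * (K + 2) := by field_simp
      have h4 : (N : ℝ) * G ^ 3 ≤ N * (80 * (π * ((K + 2) / N))) := by gcongr; linarith
      rw [mul_pow, hn3]
      have h5 : (K : ℝ) ≤ K ^ 3 := le_self_pow₀ hK1 (by norm_num)
      have h6 : π * (K + 2) ≤ 3.15 * (3 * K) :=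
        mul_le_mul pi_lt_d2.le (by linarith) (by linarith) (by norm_num)
      have h7 : (N : ℝ) * (80 * (π * ((K + 2) / N))) = 80 * (π * (K + 2)) := by
        rw [← e]; ring
      linarith
    have h4 : n * G ≤ 10 * K := le_of_pow_le_pow_left₀ (by norm_num) (by positivity) h3
    have h5 : G / π ≤ G := div_le_self hG0 (by linarith [pi_gt_three])
    exact (mul_le_mul_of_nonneg_left h5 (by linarith)).trans h4
  rw [hninv]
  have hexp : (11 + 48 * T) * (K + X) = 11 * K + 11 * X + 48 * (T * K) + 3 * X * (16 * T) := by
    ring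
  have hTK : 0 ≤ T * K := by positivity
  rw [mul_sub, mul_one] at hmain
  linarith

end EdgeForce

section Deformation

/-- Contracts the unit interval to the left of `b` towards its left endpoint `b - 1`, moving
points near `b` by `r`. -/
noncomputable def pushAway (r b x : ℝ) : ℝ := x - r * max 0 (1 - b + x)

/-- Dilation by the factor `q` about the point `b`. -/
noncomputable def dilateAbout (q b x : ℝ) : ℝ := b - q * (b - x)

variable {r b : ℝ}

theorem pushAway_le (hr0 : 0 ≤ r) (x : ℝ) : pushAway r b x ≤ x :=
  sub_le_self _ (mul_nonneg hr0 (le_max_left _ _))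

theorem mul_sub_le_pushAway_sub (hr0 : 0 ≤ r) {x y : ℝ} (h : x ≤ y) :
    (1 - r) * (y - x) ≤ pushAway r b y - pushAway r b x := by
  have : max 0 (1 - b + y) ≤ max 0 (1 - b + x) + (y - x) :=
    max_le (by linarith [le_max_left 0 (1 - b + x)]) (by linarith [le_max_right 0 (1 - b + x)])
  unfold pushAway
  nlinarith [mul_le_mul_of_nonneg_left this hr0]

theorem sub_pushAway_le (hr0 : 0 ≤ r) {x : ℝ} (hx : x ≤ b) : x - pushAway r b x ≤ r := by
  have : max 0 (1 - b + x) ≤ 1 := max_le zero_le_one (by linarith)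
  unfold pushAway
  nlinarith

theorem sub_one_le_pushAway_or_eq (hr1 : r ≤ 1) (x : ℝ) :
    b - 1 ≤ pushAway r b x ∨ pushAway r b x = x := by
  unfold pushAway
  rcases le_total (1 - b + x) 0 with h | h
  · right; rw [max_eq_left h]; ring
  · left; rw [max_eq_right h]; nlinarith

theorem inv_one_sub_le_exp (hr0 : 0 ≤ r) (hr : r ≤ 1 / 2) : (1 - r)⁻¹ ≤ exp (2 * r) := by
  have h1 : 0 < 1 - r := by linarith
  rw [inv_le_iff_one_le_mul₀ h1]
  nlinarith [add_one_le_exp (2 * r)]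

theorem antilipschitzWith_pushAway (hr0 : 0 ≤ r) (hr : r ≤ 1 / 2) :
    AntilipschitzWith (exp (2 * r)).toNNReal (pushAway r b) := by
  have key : ∀ x y : ℝ, x ≤ y → y - x ≤ exp (2 * r) * (pushAway r b y - pushAway r b x) := by
    intro x y h
    have h1 := mul_sub_le_pushAway_sub (b := b) hr0 h
    have h2 : y - x = (1 - r)⁻¹ * ((1 - r) * (y - x)) := by
      have : 1 - r ≠ 0 := by linarith
      field_simp
    rw [h2]
    have h3 : 0 ≤ (1 - r) * (y - x) := mul_nonneg (by linarith) (by linarith)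
    exact mul_le_mul (inv_one_sub_le_exp hr0 hr) h1 h3 (exp_pos _).le
  refine AntilipschitzWith.of_le_mul_dist fun x y => ?_
  rw [Real.coe_toNNReal _ (exp_pos _).le]
  rcases le_total x y with h | h
  · rw [dist_comm, dist_comm (pushAway r b x), Real.dist_eq, Real.dist_eq,
      abs_of_nonneg (sub_nonneg.2 h)]
    exact (key x y h).trans (by gcongr; exact le_abs_self _)
  · rw [Real.dist_eq, Real.dist_eq, abs_of_nonneg (sub_nonneg.2 h)]
    exact (key y x h).trans (by gcongr; exact le_abs_self _)

theorem antilipschitzWith_dilateAbout {q k : ℝ} (hq : 0 < q) (hk : q⁻¹ ≤ k) :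
    AntilipschitzWith k.toNNReal (dilateAbout q b) := by
  have hk0 : 0 < k := (inv_pos.2 hq).trans_le hk
  refine AntilipschitzWith.of_le_mul_dist fun x y => ?_
  rw [Real.coe_toNNReal _ hk0.le, Real.dist_eq, Real.dist_eq]
  have h : dilateAbout q b x - dilateAbout q b y = q * (x - y) := by unfold dilateAbout; ring
  rw [h, abs_mul, abs_of_pos hq, ← mul_assoc]
  refine le_mul_of_one_le_left (abs_nonneg _) ?_
  rwa [inv_le_iff_one_le_mul₀ hq] at hk

variable {N K : ℕ} {y : ℕ → ℝ}

theorem half_Vy_eq (hN : 1 ≤ N) (hKN : K < N) {x : ℝ} :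
    (N : ℝ) / 2 * Vy N K y x = (N : ℝ) ^ (-(1 : ℝ) / 3) * x ^ 2 / 4 - Real.log |x - y (K + 1)|
      - ∑ j ∈ Finset.Icc (K + 2) N, Real.log |x - y j| := by
  have hN0 : (0 : ℝ) < N := by exact_mod_cast hN
  have hs : ∑ j ∈ Finset.Icc (K + 1) N, Real.log |x - y j| =
      Real.log |x - y (K + 1)| + ∑ j ∈ Finset.Icc (K + 2) N, Real.log |x - y j| := by
    rw [← Finset.add_sum_erase _ _ (Finset.mem_Icc.2 ⟨le_rfl, hKN⟩)]
    congr 1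
    refine Finset.sum_congr ?_ fun _ _ => rfl
    ext j
    simp only [Finset.mem_erase, Finset.mem_Icc]
    omega
  have hp : (N : ℝ) * ((N : ℝ) ^ (-(2 : ℝ) / 3)) ^ 2 = (N : ℝ) ^ (-(1 : ℝ) / 3) := by
    rw [← Real.rpow_natCast, ← Real.rpow_mul hN0.le]
    nth_rewrite 1 [← Real.rpow_one (N : ℝ)]
    rw [← Real.rpow_add hN0]
    norm_num
  unfold Vy
  rw [hs, mul_pow, ← hp]
  field_simp
  ring

theorem half_Vy_add_log_le (hN : 1 ≤ N) (hKN : K < N)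
    (hy : ∀ j k : ℕ, K + 1 ≤ j → j < k → k ≤ N → y j < y k) {M : ℝ} (hM0 : 0 ≤ M)
    (hM : -M ≤ (N : ℝ) ^ (-(1 : ℝ) / 3) * (y (K + 1) - 1) / 2
        + ∑ j ∈ Finset.Icc (K + 2) N, 1 / (y j - y (K + 1) + 1))
    {x x' : ℝ} (hx : x < y (K + 1)) (hx' : x' ≤ x) (hr : x - x' ≤ r)
    (h : y (K + 1) - 1 ≤ x' ∨ x' = x) :
    (N : ℝ) / 2 * Vy N K y x' + Real.log (y (K + 1) - x') ≤
      (N : ℝ) / 2 * Vy N K y x + Real.log (y (K + 1) - x) + M * r := by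
  have hr0 : 0 ≤ r := by linarith
  rcases h with h | rfl
  swap
  · linarith [mul_nonneg hM0 hr0]
  have habs : ∀ z, z < y (K + 1) → |z - y (K + 1)| = y (K + 1) - z := fun z hz => by
    rw [abs_of_neg (by linarith)]; ring
  rw [half_Vy_eq hN hKN, half_Vy_eq hN hKN, habs x hx, habs x' (by linarith)]
  set b := y (K + 1) with hb
  set n := (N : ℝ) ^ (-(1 : ℝ) / 3) with hn
  have hn0 : 0 < n := Real.rpow_pos_of_pos (by exact_mod_cast hN) _
  have hlog : ∀ j ∈ Finset.Icc (K + 2) N,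
      (x - x') * (1 / (y j - b + 1)) ≤ Real.log |x' - y j| - Real.log |x - y j| := by
    intro j hj
    rw [Finset.mem_Icc] at hj
    have hbj : b < y j := hy (K + 1) j le_rfl (by omega) hj.2
    have e1 : |x' - y j| = y j - x' := by rw [abs_of_neg (by linarith)]; ring
    have e2 : |x - y j| = y j - x := by rw [abs_of_neg (by linarith)]; ring
    have p1 : 0 < y j - x := by linarith
    have p2 : 0 < y j - x' := by linarith
    rw [e1, e2, ← Real.log_div p2.ne' p1.ne']
    have h1 := Real.one_sub_inv_le_log_of_pos (div_pos p2 p1)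
    have h2 : 1 - ((y j - x') / (y j - x))⁻¹ = (x - x') * (1 / (y j - x')) := by
      field_simp; ring
    rw [h2] at h1
    refine le_trans ?_ h1
    have h3 : 1 / (y j - b + 1) ≤ 1 / (y j - x') := one_div_le_one_div_of_le p2 (by linarith)
    exact mul_le_mul_of_nonneg_left h3 (by linarith)
  have hs := Finset.sum_le_sum hlog
  rw [← Finset.mul_sum, Finset.sum_sub_distrib] at hs
  have h1 : n * (b - 1) / 2 * (x - x') ≤ n * x ^ 2 / 4 - n * x' ^ 2 / 4 := by
    have : (b - 1) * 2 * (x - x') ≤ (x + x') * (x - x') :=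
      mul_le_mul_of_nonneg_right (by linarith) (by linarith)
    nlinarith
  have h2 := mul_le_mul_of_nonneg_right hM (sub_nonneg.2 hx')
  have h3 : M * (x - x') ≤ M * r := mul_le_mul_of_nonneg_left hr hM0
  nlinarith

/-- Pushes the top particle away from `b` by the dilation factor `r / t` and moves the other
particles out of its way. -/
noncomputable def openGap (l : Fin K) (r t b : ℝ) (i : Fin K) : ℝ → ℝ :=
  if i = l then dilateAbout (r / t) b else pushAway r b

variable {l : Fin K} {t : ℝ} {x : Fin K → ℝ}

theorem openGap_sub_ge (hl : ∀ i, i ≤ l) (ht : 0 < t) (htr : t ≤ r) (hr1 : r ≤ 1)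
    (hmono : ∀ i j : Fin K, i < j → x i < x j) (hxb : ∀ i, x i < b) (hgap : b - x l ≤ t)
    {i j : Fin K} (hij : i < j) :
    (1 - r) * (x j - x i) ≤ openGap l r t b j (x j) - openGap l r t b i (x i) := by
  have hr0 : 0 < r := ht.trans_le htr
  have hil : i ≠ l := (hij.trans_le (hl j)).ne
  have hxij := hmono i j hij
  by_cases hj : j = l
  · subst hj
    simp only [openGap, hil, if_true, if_false, dilateAbout, pushAway]
    have h1 : r / t * (b - x j) ≤ r := by
      calc r / t * (b - x j) ≤ r / t * t := by gcongr
        _ = r := by field_simp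
    have h2 := le_max_right 0 (1 - b + x i)
    have := hxb j
    nlinarith [mul_le_mul_of_nonneg_left h2 hr0.le]
  · simp only [openGap, hil, hj, if_false]
    exact mul_sub_le_pushAway_sub hr0.le hxij.le

theorem openGap_bounds (ht : 0 < t) (htr : t ≤ r) (hr1 : r ≤ 1)
    (hxb : ∀ i, x i < b) (hgap : b - x l ≤ t) (i : Fin K) :
    openGap l r t b i (x i) ≤ x i ∧ x i - openGap l r t b i (x i) ≤ r ∧
      (b - 1 ≤ openGap l r t b i (x i) ∨ openGap l r t b i (x i) = x i) := by
  have hr0 : 0 < r := ht.trans_le htr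
  by_cases hi : i = l
  · subst hi
    simp only [openGap, if_true, dilateAbout]
    have h1 : r / t * (b - x i) ≤ r := by
      calc r / t * (b - x i) ≤ r / t * t := by gcongr
        _ = r := by field_simp
    have h2 : b - x i ≤ r / t * (b - x i) :=
      le_mul_of_one_le_left (by linarith [hxb i]) ((one_le_div ht).2 htr)
    have := hxb i
    exact ⟨by linarith, by linarith, Or.inl (by linarith)⟩
  · simp only [openGap, hi, if_false]
    exact ⟨pushAway_le hr0.le _, sub_pushAway_le hr0.le (hxb i).le,
      sub_one_le_pushAway_or_eq hr1 _⟩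

theorem neg_mul_Hy_openGap_ge (hN : 1 ≤ N) (hKN : K < N)
    (hy : ∀ j k : ℕ, K + 1 ≤ j → j < k → k ≤ N → y j < y k) {M : ℝ} (hM0 : 0 ≤ M)
    (hM : -M ≤ (N : ℝ) ^ (-(1 : ℝ) / 3) * (y (K + 1) - 1) / 2
        + ∑ j ∈ Finset.Icc (K + 2) N, 1 / (y j - y (K + 1) + 1))
    (hl : ∀ i, i ≤ l) (ht : 0 < t) (htr : t ≤ r) (hr : r ≤ 1 / 2)
    (hmono : ∀ i j : Fin K, i < j → x i < x j) (hxb : ∀ i, x i < y (K + 1))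
    (hgap : y (K + 1) - x l ≤ t) :
    -(N * Hy N K y x) + Real.log (r / t) - (2 * r * K ^ 2 + K * (M * r)) ≤
      -(N * Hy N K y fun i => openGap l r t (y (K + 1)) i (x i)) := by
  set b := y (K + 1) with hb
  set x' : Fin K → ℝ := fun i => openGap l r t b i (x i) with hx'
  have hr0 : 0 < r := ht.trans_le htr
  have hN0 : (N : ℝ) ≠ 0 := by
    have : N ≠ 0 := by omega
    exact_mod_cast this
  have hH : ∀ z : Fin K → ℝ, N * Hy N K y z = ∑ i, (N : ℝ) / 2 * Vy N K y (z i)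
      - ∑ i : Fin K, ∑ j : Fin K, if i < j then Real.log (z j - z i) else 0 := by
    intro z
    unfold Hy
    rw [← Finset.mul_sum]
    field_simp
  have hbd := openGap_bounds (l := l) ht htr (by linarith : r ≤ 1) hxb hgap
  have hone : ∑ i, ((N : ℝ) / 2 * Vy N K y (x' i) + (Real.log (b - x' i) - Real.log (b - x i))) ≤
      ∑ i, ((N : ℝ) / 2 * Vy N K y (x i) + M * r) := by
    refine Finset.sum_le_sum fun i _ => ?_
    have := half_Vy_add_log_le hN hKN hy hM0 hM (hxb i) (hbd i).1 (hbd i).2.1 (hbd i).2.2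
    linarith
  have hlog : Real.log (r / t) ≤ ∑ i, (Real.log (b - x' i) - Real.log (b - x i)) := by
    have h0 : ∀ i ∈ Finset.univ, 0 ≤ Real.log (b - x' i) - Real.log (b - x i) := fun i _ =>
      sub_nonneg.2 (Real.log_le_log (by linarith [hxb i]) (by linarith [(hbd i).1]))
    refine le_trans (le_of_eq ?_) (Finset.single_le_sum h0 (Finset.mem_univ l))
    have hlb : 0 < b - x l := by linarith [hxb l]
    have : b - x' l = r / t * (b - x l) := by simp [hx', openGap, dilateAbout]
    rw [this, Real.log_mul (by positivity) hlb.ne']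
    ring
  have hpair : ∑ i : Fin K, ∑ j : Fin K, ((if i < j then Real.log (x j - x i) else 0) - 2 * r) ≤
      ∑ i : Fin K, ∑ j : Fin K, if i < j then Real.log (x' j - x' i) else 0 := by
    refine Finset.sum_le_sum fun i _ => Finset.sum_le_sum fun j _ => ?_
    split_ifs with hij
    · have h1 := openGap_sub_ge hl ht htr (by linarith : r ≤ 1) hmono hxb hgap hij
      have h2 : 0 < x j - x i := sub_pos.2 (hmono i j hij)
      have h3 : 0 < 1 - r := by linarith
      have h4 := Real.log_le_log (mul_pos h3 h2) h1
      rw [Real.log_mul h3.ne' h2.ne'] at h4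
      have h5 : -(2 * r) ≤ Real.log (1 - r) := by
        have := Real.log_le_log (inv_pos.2 h3) (inv_one_sub_le_exp hr0.le hr)
        rw [Real.log_inv, Real.log_exp] at this
        linarith
      simp only [hx']
      linarith
    · linarith
  simp only [Finset.sum_add_distrib, Finset.sum_sub_distrib, Finset.sum_const, Finset.card_univ,
    Fintype.card_fin, nsmul_eq_mul] at hone hpair hlog
  rw [hH x, hH x']
  linarith

end Deformation

section Repulsion

variable {β r t : ℝ} {N K : ℕ} {y : ℕ → ℝ} {l : Fin K}

theorem measurable_condDensity (β : ℝ) (N K : ℕ) (y : ℕ → ℝ) :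
    Measurable (condDensity β N K y) := by
  unfold condDensity
  refine Measurable.ite ?_ ?_ measurable_const
  · simp only [Set.ofPred_and, Set.ofPred_forall]
    refine MeasurableSet.inter ?_ ?_
    · exact MeasurableSet.iInter fun i => MeasurableSet.iInter fun j =>
        MeasurableSet.iInter fun _ => measurableSet_lt (measurable_pi_apply i)
          (measurable_pi_apply j)
    · exact MeasurableSet.iInter fun i =>
        measurableSet_lt (measurable_pi_apply i) measurable_const
  · have hV : Measurable (Vy N K y) := by
      unfold Vy
      refine Measurable.sub (by fun_prop) (measurable_const.mul ?_)
      refine Finset.measurable_sum _ fun j _ => ?_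
      exact Real.measurable_log.comp (continuous_abs.measurable.comp (by fun_prop))
    have hH : Measurable (Hy N K y) := by
      unfold Hy
      refine Measurable.sub (measurable_const.mul ?_) (measurable_const.mul ?_)
      · exact Finset.measurable_sum _ fun i _ => hV.comp (measurable_pi_apply i)
      · refine Finset.measurable_sum _ fun i _ => Finset.measurable_sum _ fun j _ => ?_
        split_ifs
        · exact Real.measurable_log.comp
            ((measurable_pi_apply j).sub (measurable_pi_apply i))
        · exact measurable_const
    exact Real.measurable_exp.comp (measurable_const.mul hH)

theorem condDensity_le_openGap (hβ : 0 ≤ β) (hN : 1 ≤ N) (hKN : K < N)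
    (hy : ∀ j k : ℕ, K + 1 ≤ j → j < k → k ≤ N → y j < y k) {M : ℝ} (hM0 : 0 ≤ M)
    (hM : -M ≤ (N : ℝ) ^ (-(1 : ℝ) / 3) * (y (K + 1) - 1) / 2
        + ∑ j ∈ Finset.Icc (K + 2) N, 1 / (y j - y (K + 1) + 1))
    (hl : ∀ i, i ≤ l) (ht : 0 < t) (htr : t ≤ r) (hr : r ≤ 1 / 2)
    {x : Fin K → ℝ} (hgap : y (K + 1) - x l ≤ t) :
    condDensity β N K y x ≤ exp (β * (2 * r * K ^ 2 + K * (M * r))) * (t / r) ^ β *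
      condDensity β N K y (fun i => openGap l r t (y (K + 1)) i (x i)) := by
  have hr0 : 0 < r := ht.trans_le htr
  by_cases hx : (∀ i j : Fin K, i < j → x i < x j) ∧ ∀ i : Fin K, x i < y (K + 1)
  swap
  · have h0 : condDensity β N K y x = 0 := if_neg hx
    rw [h0]
    have : 0 ≤ condDensity β N K y (fun i => openGap l r t (y (K + 1)) i (x i)) := by
      unfold condDensity
      split_ifs
      · exact (exp_pos _).le
      · exact le_rfl
    positivity
  obtain ⟨hmono, hxb⟩ := hx
  set x' : Fin K → ℝ := fun i => openGap l r t (y (K + 1)) i (x i) with hx'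
  have hx'mem : (∀ i j : Fin K, i < j → x' i < x' j) ∧ ∀ i : Fin K, x' i < y (K + 1) := by
    refine ⟨fun i j hij => ?_, fun i => ?_⟩
    · have h1 := openGap_sub_ge hl ht htr (by linarith : r ≤ 1) hmono hxb hgap hij
      have h2 : 0 < (1 - r) * (x j - x i) :=
        mul_pos (by linarith) (sub_pos.2 (hmono i j hij))
      exact sub_pos.1 (h2.trans_le h1)
    · exact (openGap_bounds ht htr (by linarith : r ≤ 1) hxb hgap i).1.trans_lt (hxb i)
  have hf : condDensity β N K y x = exp (-(β * (N : ℝ)) * Hy N K y x) := if_pos ⟨hmono, hxb⟩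
  have hf' : condDensity β N K y x' = exp (-(β * (N : ℝ)) * Hy N K y x') := if_pos hx'mem
  have hE := neg_mul_Hy_openGap_ge hN hKN hy hM0 hM hl ht htr hr hmono hxb hgap
  rw [hf, hf', Real.rpow_def_of_pos (div_pos ht hr0), ← exp_add, ← exp_add, exp_le_exp]
  have hlog : Real.log (t / r) = -Real.log (r / t) := by rw [← Real.log_inv, inv_div]
  rw [hlog]
  have := mul_le_mul_of_nonneg_left hE hβ
  linarith

theorem measurable_openGap (l : Fin K) (r t b : ℝ) (i : Fin K) :
    Measurable (openGap l r t b i) := by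
  unfold openGap
  split_ifs
  · unfold dilateAbout; fun_prop
  · unfold pushAway; fun_prop

theorem map_openGap_volume_le (b : ℝ) (ht : 0 < t) (htr : t ≤ r) (hr : r ≤ 1 / 2) :
    Measure.map (fun (x : Fin K → ℝ) i => openGap l r t b i (x i)) volume ≤
      ENNReal.ofReal (exp (2 * r * K) * (t / r)) • (volume : Measure (Fin K → ℝ)) := by
  have hr0 : 0 < r := ht.trans_le htr
  set k : Fin K → ℝ := fun i => exp (2 * r) * if i = l then t / r else 1 with hk
  have hkpos : ∀ i, 0 < k i := fun i => by
    simp only [hk]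
    split_ifs <;> positivity
  have h := map_piMap_volume_le (k := fun i => (k i).toNNReal)
    (φ := fun i => openGap l r t b i) (fun i => by simpa using hkpos i) (fun i => ?_)
    (measurable_openGap l r t b)
  · refine h.trans_eq ?_
    congr 1
    change ∏ i, ENNReal.ofReal (k i) = _
    rw [← ENNReal.ofReal_prod_of_nonneg fun i _ => (hkpos i).le]
    congr 1
    simp only [hk, Finset.prod_mul_distrib, Finset.prod_const, Finset.card_univ,
      Fintype.card_fin, Finset.prod_ite_eq', Finset.mem_univ, if_true]
    rw [← exp_nat_mul]
    ring_nf
  · by_cases hi : i = l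
    · simp only [openGap, hi, hk, if_true]
      refine antilipschitzWith_dilateAbout (by positivity) ?_
      rw [inv_div]
      exact le_mul_of_one_le_left (by positivity) (one_le_exp (by positivity))
    · simp only [openGap, hi, hk, if_false, mul_one]
      exact antilipschitzWith_pushAway hr0.le hr

/-- A gap of size at most `t` next to the boundary can be opened up to size `r`. -/
theorem measure_gap_le (hβ : 0 ≤ β) (hN : 1 ≤ N) (hKN : K < N)
    (hy : ∀ j k : ℕ, K + 1 ≤ j → j < k → k ≤ N → y j < y k) {M : ℝ} (hM0 : 0 ≤ M)
    (hM : -M ≤ (N : ℝ) ^ (-(1 : ℝ) / 3) * (y (K + 1) - 1) / 2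
        + ∑ j ∈ Finset.Icc (K + 2) N, 1 / (y j - y (K + 1) + 1))
    (hl : ∀ i, i ≤ l) (ht : 0 < t) (hr0 : 0 < r) (hr : r ≤ 1 / 2)
    {P : Measure (Fin K → ℝ)} (hP : IsProbabilityMeasure P) {Z : ℝ≥0∞}
    (hPZ : P = Z⁻¹ • (volume.withDensity fun x => ENNReal.ofReal (condDensity β N K y x))) :
    P {x | y (K + 1) - x l ≤ t} ≤ ENNReal.ofReal
      (exp (β * (2 * r * K ^ 2 + K * (M * r)) + 2 * r * K) * (t / r) ^ (β + 1)) := by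
  rcases lt_or_ge r t with htr | htr
  · refine prob_le_one.trans ?_
    rw [← ENNReal.ofReal_one]
    refine ENNReal.ofReal_le_ofReal (one_le_mul_of_one_le_of_one_le ?_ ?_)
    · exact one_le_exp (by positivity)
    · exact Real.one_le_rpow ((one_le_div hr0).2 htr.le) (by linarith)
  set f : (Fin K → ℝ) → ℝ≥0∞ := fun x => ENNReal.ofReal (condDensity β N K y x) with hf
  have hfm : Measurable f := (measurable_condDensity β N K y).ennreal_ofReal
  set S : (Fin K → ℝ) → Fin K → ℝ := fun x i => openGap l r t (y (K + 1)) i (x i) with hS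
  have hSm : Measurable S := measurable_pi_lambda _ fun i =>
    (measurable_openGap l r t _ i).comp (measurable_pi_apply i)
  have htot : Z⁻¹ * ∫⁻ x, f x = 1 := by
    have := hP.measure_univ
    rw [hPZ, Measure.smul_apply, withDensity_apply' _, smul_eq_mul, setLIntegral_univ] at this
    exact this
  set A : Set (Fin K → ℝ) := {x | y (K + 1) - x l ≤ t} with hA
  have hAm : MeasurableSet A :=
    measurableSet_le (measurable_const.sub (measurable_pi_apply l)) measurable_const
  set c₁ : ℝ := exp (β * (2 * r * K ^ 2 + K * (M * r))) * (t / r) ^ β with hc₁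
  set c₂ : ℝ := exp (2 * r * K) * (t / r) with hc₂
  have hc₁0 : 0 ≤ c₁ := by positivity
  have hint : ∫⁻ x in A, f x ≤ ENNReal.ofReal c₁ * (ENNReal.ofReal c₂ * ∫⁻ x, f x) := by
    calc ∫⁻ x in A, f x ≤ ∫⁻ x in A, ENNReal.ofReal c₁ * f (S x) := by
          refine setLIntegral_mono' hAm fun x hx => ?_
          rw [hf, ← ENNReal.ofReal_mul hc₁0]
          exact ENNReal.ofReal_le_ofReal
            (condDensity_le_openGap hβ hN hKN hy hM0 hM hl ht htr hr hx)
      _ ≤ ∫⁻ x, ENNReal.ofReal c₁ * f (S x) := setLIntegral_le_lintegral _ _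
      _ = ENNReal.ofReal c₁ * ∫⁻ x, f x ∂(Measure.map S volume) := by
          rw [lintegral_map hfm hSm, ← lintegral_const_mul _ (show Measurable fun x => f (S x) from
            hfm.comp hSm)]
      _ ≤ ENNReal.ofReal c₁ * ∫⁻ x, f x ∂(ENNReal.ofReal c₂ • volume) := by
          gcongr
          exact map_openGap_volume_le _ ht htr hr
      _ = _ := by rw [lintegral_smul_measure, smul_eq_mul]
  rw [hPZ, Measure.smul_apply, withDensity_apply' _, smul_eq_mul]
  calc Z⁻¹ * ∫⁻ x in A, f x ≤ Z⁻¹ * (ENNReal.ofReal c₁ * (ENNReal.ofReal c₂ * ∫⁻ x, f x)) := by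
        gcongr
    _ = ENNReal.ofReal c₁ * ENNReal.ofReal c₂ * (Z⁻¹ * ∫⁻ x, f x) := by ring
    _ = ENNReal.ofReal (c₁ * c₂) := by rw [htot, mul_one, ENNReal.ofReal_mul hc₁0]
    _ = _ := by
        rw [hc₁, hc₂, Real.rpow_add (div_pos ht hr0), Real.rpow_one, exp_add]
        ring_nf

end Repulsion

/-- Level repulsion for the conditioned measure `μ_y` with good boundary data `y ∈ R_K(ξ)`. -/
theorem cond_level_repulsion (β : ℝ) (hβ : 1 ≤ β) :
    ∃ C ξ₀ : ℝ, 0 < C ∧ 0 < ξ₀ ∧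
      ∀ ξ : ℝ, 0 < ξ → ξ ≤ ξ₀ →
      ∀ N : ℕ, 2 ≤ N →
      ∀ K : ℕ, ∀ hK : 1 ≤ K, (K : ℝ) ≤ (N : ℝ) ^ ((1 : ℝ) / 2) →
      ∀ γ : ℕ → ℝ,
        (∀ k : ℕ, 1 ≤ k → k ≤ N → (k : ℝ) / N = ∫ E in (-2 : ℝ)..(γ k), semicircle E) →
      ∀ y : ℕ → ℝ,
        (∀ j k : ℕ, K + 1 ≤ j → j < k → k ≤ N → y j < y k) →
        (∀ k : ℕ, K + 1 ≤ k → k ≤ N →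
          |y k - (N : ℝ) ^ ((2 : ℝ) / 3) * γ k| ≤
            (N : ℝ) ^ ξ * ((min k (N + 1 - k) : ℕ) : ℝ) ^ (-(1 : ℝ) / 3)) →
      ∀ P : Measure (Fin K → ℝ), IsProbabilityMeasure P →
      (∃ Z : ℝ≥0∞, Z ≠ 0 ∧ Z ≠ ⊤ ∧
        P = Z⁻¹ • (volume.withDensity fun x => ENNReal.ofReal (condDensity β N K y x))) →
      ∀ s : ℝ, 0 < s →
      P {x | y (K + 1) - x ⟨K - 1, by omega⟩ ≤ s * (K : ℝ) ^ (-(1 : ℝ) / 3)} ≤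
        ENNReal.ofReal (C * s ^ (β + 1) *
          ((K : ℝ) ^ 2 + (K : ℝ) * (N : ℝ) ^ (C * ξ)) ^ (β + 1)) := by
  obtain ⟨C₁, hC₁, hforce⟩ := exists_edge_force_bound
  set C : ℝ := exp (β * (1 + C₁) + 1) * 2 ^ (β + 1) with hC
  have hC1 : 1 ≤ C := one_le_mul_of_one_le_of_one_le (one_le_exp (by positivity))
    (Real.one_le_rpow one_le_two (by linarith))
  refine ⟨C, 1, by linarith, one_pos, fun ξ hξ _ N hN K hK hKN γ hγ y hy hrig P hP hPZ s hs => ?_⟩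
  obtain ⟨Z, -, -, hPZ⟩ := hPZ
  have hN1 : (1 : ℝ) ≤ N := by exact_mod_cast (by omega : 1 ≤ N)
  have hN0 : (0 : ℝ) < N := by linarith
  have hK1 : (1 : ℝ) ≤ K := by exact_mod_cast hK
  have hlt : K < N := by
    have h1 : (N : ℝ) ^ ((1 : ℝ) / 2) < N := by
      conv_rhs => rw [← Real.rpow_one (N : ℝ)]
      exact Real.rpow_lt_rpow_of_exponent_lt (by exact_mod_cast hN) (by norm_num)
    exact_mod_cast hKN.trans_lt h1
  have hf := hforce ξ hξ N K hK hlt γ hγ y hy hrig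
  set X := (N : ℝ) ^ ξ with hX
  have hX1 : 1 ≤ X := Real.one_le_rpow hN1 hξ.le
  have hXC : X ≤ (N : ℝ) ^ (C * ξ) :=
    Real.rpow_le_rpow_of_exponent_le hN1 (le_mul_of_one_le_left hξ.le hC1)
  set Q : ℝ := (K : ℝ) ^ 2 + K * X with hQ
  have hK2 : (K : ℝ) ≤ K ^ 2 := le_self_pow₀ hK1 two_ne_zero
  have hKX : (1 : ℝ) ≤ K * X := one_le_mul_of_one_le_of_one_le hK1 hX1
  have hQ1 : 1 ≤ Q := by linarith
  set r : ℝ := 1 / (2 * Q) with hr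
  have hr0 : 0 < r := by positivity
  have hrQ : r * Q = 1 / 2 := by rw [hr]; field_simp
  have hr2 : r ≤ 1 / 2 := by nlinarith
  have ht : 0 < s * (K : ℝ) ^ (-(1 : ℝ) / 3) := by positivity
  have hts : s * (K : ℝ) ^ (-(1 : ℝ) / 3) ≤ s :=
    mul_le_of_le_one_right hs.le (Real.rpow_le_one_of_one_le_of_nonpos hK1 (by norm_num))
  refine (measure_gap_le (by linarith) (by omega) hlt hy (by positivity) hf
    (l := ⟨K - 1, by omega⟩) (fun i => ?_) ht hr0 hr2 hP hPZ).trans ?_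
  · rw [Fin.le_def]
    have := i.2
    simp only
    omega
  refine ENNReal.ofReal_le_ofReal ?_
  have hexp : β * (2 * r * K ^ 2 + K * (C₁ * (K + X) * r)) + 2 * r * K ≤ β * (1 + C₁) + 1 := by
    have h1 : r * K ^ 2 ≤ r * Q := by gcongr; linarith
    have h2 : r * K ≤ r * Q := by gcongr; linarith
    have h3 : K * (C₁ * (K + X) * r) = C₁ * (r * Q) := by rw [hQ]; ring
    rw [h3, hrQ]
    have h4 : 2 * r * K ^ 2 + C₁ * (1 / 2) ≤ 1 + C₁ := by linarith
    have := mul_le_mul_of_nonneg_left h4 (by linarith : 0 ≤ β)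
    linarith
  have hdiv : s * (K : ℝ) ^ (-(1 : ℝ) / 3) / r ≤ 2 * (s * (K ^ 2 + K * (N : ℝ) ^ (C * ξ))) := by
    calc s * (K : ℝ) ^ (-(1 : ℝ) / 3) / r ≤ s / r := by gcongr
      _ = 2 * (s * Q) := by rw [hr]; field_simp
      _ ≤ _ := by rw [hQ]; gcongr
  calc _ ≤ exp (β * (1 + C₁) + 1) * (2 * (s * (K ^ 2 + K * (N : ℝ) ^ (C * ξ)))) ^ (β + 1) := by
        gcongr
    _ = _ := by
        rw [Real.mul_rpow (by norm_num) (by positivity), Real.mul_rpow hs.le (by positivity), hC]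
        ring
end

section
/- (Lemma 3.4, comparison of the x- and y-mean-field terms.) Fix exponents 0 < ω_K < 1/10 and 0 < δ_c < 10^{−3}. There is a constant C > 0 such that the following holds for all integers N ≥ 2 and M with N ≤ M ≤ 10N. Set K = N^{ω_K}, let γ_i^{(x)} = N^{2/3}(γ_i^{(N)} + 2) and γ_i^{(y)} = M^{2/3}(γ_i^{(M)} + 2), and let ν^{(x)}(E) = N^{1/3} ρ_sc(N^{−2/3}E − 2) and ν^{(y)}(E) = M^{1/3} ρ_sc(M^{−2/3}E − 2). Then for every real a satisfying −γ^{(x)}_{⌊K⌋} ≤ a ≤ γ^{(x)}_{⌊K + K^{δ_c} − K^{δ_c/2}⌋}, one has |∫_{γ^{(x)}_{⌊K+K^{δ_c}⌋}}^{∞} ν^{(x)}(x)/(a − x) dx + N^{1/3} − M^{1/3} − ∫_{γ^{(y)}_{⌊K+K^{δ_c}⌋}}^{∞} ν^{(y)}(x)/(a − x) dx| ≤ C N^{−1/3} (log N) K. -/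
open MeasureTheory Real

/-- The edge-rescaled semicircle density associated to a system of size `n`. -/
noncomputable def nuEdge (n : ℕ) (E : ℝ) : ℝ :=
  (n : ℝ) ^ ((1 : ℝ) / 3) * semicircle ((n : ℝ) ^ (-(2 : ℝ) / 3) * E - 2)

/-- The edge density with parameter `p`; taking `p = n ^ (-2/3)` gives `nuEdge n`. -/
noncomputable def edgeDensity (p x : ℝ) : ℝ := √x * √(1 - p * x / 4) / π

/-- The mass of `√x / π` on `[0, s]`. -/
noncomputable def sqrtMass (s : ℝ) : ℝ := 2 / (3 * π) * (s * √s)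

theorem semicircle_edge {p : ℝ} (hp : 0 < p) (x : ℝ) :
    semicircle (p * x - 2) = √p * edgeDensity p x := by
  unfold semicircle edgeDensity
  have hpi := Real.pi_pos
  split_ifs with h
  · rw [abs_le] at h
    have hx : 0 ≤ x := by
      by_contra! hx
      nlinarith
    have e : 4 - (p * x - 2) ^ 2 = 2 ^ 2 * (p * (x * (1 - p * x / 4))) := by ring
    rw [e, Real.sqrt_mul (by norm_num), Real.sqrt_sq (by norm_num), Real.sqrt_mul hp.le,
      Real.sqrt_mul hx]
    field_simp
  · rw [abs_le, not_and_or, not_le, not_le] at h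
    rcases h with h | h
    · have : x ≤ 0 := by
        by_contra! hx
        nlinarith
      rw [Real.sqrt_eq_zero_of_nonpos this]
      simp
    · have : 1 - p * x / 4 ≤ 0 := by linarith
      rw [Real.sqrt_eq_zero_of_nonpos this]
      simp

theorem sqrt_rpow_neg_two_thirds {n : ℝ} (hn : 0 < n) :
    √(n ^ (-(2 : ℝ) / 3)) = n ^ (-(1 : ℝ) / 3) := by
  rw [Real.sqrt_eq_rpow, ← Real.rpow_mul hn.le]
  norm_num

theorem nuEdge_eq {n : ℕ} (hn : 0 < n) (x : ℝ) :
    nuEdge n x = edgeDensity ((n : ℝ) ^ (-(2 : ℝ) / 3)) x := by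
  have hn' : (0 : ℝ) < n := by exact_mod_cast hn
  unfold nuEdge
  rw [semicircle_edge (by positivity), sqrt_rpow_neg_two_thirds hn', ← mul_assoc,
    ← Real.rpow_add hn']
  norm_num

theorem continuous_edgeDensity (p : ℝ) : Continuous (edgeDensity p) := by
  unfold edgeDensity
  fun_prop

theorem edgeDensity_nonneg (p x : ℝ) : 0 ≤ edgeDensity p x := by
  unfold edgeDensity
  positivity

theorem edgeDensity_of_nonpos (p : ℝ) {x : ℝ} (hx : x ≤ 0) : edgeDensity p x = 0 := by
  simp [edgeDensity, Real.sqrt_eq_zero_of_nonpos hx]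

theorem edgeDensity_of_le {p x : ℝ} (hp : 0 < p) (hx : 4 / p ≤ x) : edgeDensity p x = 0 := by
  have : 1 - p * x / 4 ≤ 0 := by
    rw [div_le_iff₀ hp] at hx
    linarith
  simp [edgeDensity, Real.sqrt_eq_zero_of_nonpos this]

theorem edgeDensity_pos {p x : ℝ} (hp : 0 < p) (hx : 0 < x) (hx' : x < 4 / p) :
    0 < edgeDensity p x := by
  have h : 0 < 1 - p * x / 4 := by
    rw [lt_div_iff₀ hp] at hx'
    linarith
  have := Real.pi_pos
  unfold edgeDensity
  positivity

theorem edgeDensity_anti {p q x : ℝ} (hqp : q ≤ p) (hx : 0 ≤ x) :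
    edgeDensity p x ≤ edgeDensity q x := by
  unfold edgeDensity
  have : q * x ≤ p * x := mul_le_mul_of_nonneg_right hqp hx
  gcongr

theorem edgeDensity_le_sqrt {p x : ℝ} (hp : 0 ≤ p) (hx : 0 ≤ x) :
    edgeDensity p x ≤ √x / π := by
  simpa [edgeDensity] using edgeDensity_anti hp hx

theorem edgeDensity_sub_le {p q x : ℝ} (hp : 0 ≤ p) (hq : 0 ≤ q) (hx : 0 ≤ x) :
    edgeDensity q x - edgeDensity p x ≤ p * x / 4 * (√x / π) := by
  have h1 := edgeDensity_le_sqrt hq hx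
  have h2 : 1 - p * x / 4 ≤ √(1 - p * x / 4) := by
    rcases le_or_gt (1 - p * x / 4) 0 with h | h
    · exact h.trans (Real.sqrt_nonneg _)
    · apply Real.le_sqrt_of_sq_le
      nlinarith [mul_nonneg hp hx]
  have h3 : √x / π * (1 - p * x / 4) ≤ edgeDensity p x := by
    unfold edgeDensity
    rw [mul_div_right_comm (√x)]
    exact mul_le_mul_of_nonneg_left h2 (by positivity)
  linarith

theorem integral_sqrt_div_pi {s : ℝ} (hs : 0 ≤ s) : ∫ x in (0 : ℝ)..s, √x / π = sqrtMass s := by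
  have h : ∀ x : ℝ, √x = x ^ ((1 : ℝ) / 2) := fun x => Real.sqrt_eq_rpow x
  rw [intervalIntegral.integral_div]
  simp_rw [h]
  rw [integral_rpow (by left; norm_num), sqrtMass, Real.sqrt_eq_rpow]
  have e : s ^ ((1 : ℝ) / 2 + 1) = s * s ^ ((1 : ℝ) / 2) := by
    rw [Real.rpow_add_one' hs (by norm_num), mul_comm]
  rw [e, Real.zero_rpow (by norm_num)]
  field_simp
  ring

theorem integral_edgeDensity_mono {p s t : ℝ} (hst : s ≤ t) :
    ∫ x in (0 : ℝ)..s, edgeDensity p x ≤ ∫ x in (0 : ℝ)..t, edgeDensity p x := by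
  have h := intervalIntegral.integral_add_adjacent_intervals
    ((continuous_edgeDensity p).intervalIntegrable (μ := volume) 0 s)
    ((continuous_edgeDensity p).intervalIntegrable (μ := volume) s t)
  have h2 : 0 ≤ ∫ x in s..t, edgeDensity p x :=
    intervalIntegral.integral_nonneg hst fun x _ => edgeDensity_nonneg p x
  linarith

theorem integral_edgeDensity_of_nonpos (p : ℝ) {s : ℝ} (hs : s ≤ 0) :
    ∫ x in (0 : ℝ)..s, edgeDensity p x = 0 := by
  rw [intervalIntegral.integral_congr (g := fun _ => (0 : ℝ))]
  · simp
  · intro x hx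
    rw [Set.uIcc_of_ge hs] at hx
    exact edgeDensity_of_nonpos p hx.2

theorem integral_edgeDensity_min {p : ℝ} (hp : 0 < p) (s : ℝ) :
    ∫ x in (0 : ℝ)..min s (4 / p), edgeDensity p x = ∫ x in (0 : ℝ)..s, edgeDensity p x := by
  rcases le_total s (4 / p) with h | h
  · rw [min_eq_left h]
  · rw [min_eq_right h, ← intervalIntegral.integral_add_adjacent_intervals
      ((continuous_edgeDensity p).intervalIntegrable 0 (4 / p))
      ((continuous_edgeDensity p).intervalIntegrable (4 / p) s),
      intervalIntegral.integral_congr (a := 4 / p) (g := fun _ => (0 : ℝ))]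
    · simp
    · intro x hx
      rw [Set.uIcc_of_le h] at hx
      exact edgeDensity_of_le hp hx.1

theorem integral_edgeDensity_anti {p q s : ℝ} (hqp : q ≤ p) (hs : 0 ≤ s) :
    ∫ x in (0 : ℝ)..s, edgeDensity p x ≤ ∫ x in (0 : ℝ)..s, edgeDensity q x :=
  intervalIntegral.integral_mono_on hs ((continuous_edgeDensity p).intervalIntegrable _ _)
    ((continuous_edgeDensity q).intervalIntegrable _ _)
    fun _ hx => edgeDensity_anti hqp hx.1

theorem continuous_sqrt_div_pi : Continuous fun x : ℝ => √x / π := by fun_prop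

theorem integral_edgeDensity_le {p s : ℝ} (hp : 0 ≤ p) (hs : 0 ≤ s) :
    ∫ x in (0 : ℝ)..s, edgeDensity p x ≤ sqrtMass s := by
  rw [← integral_sqrt_div_pi hs]
  exact intervalIntegral.integral_mono_on hs ((continuous_edgeDensity p).intervalIntegrable _ _)
    (continuous_sqrt_div_pi.intervalIntegrable _ _) fun _ hx => edgeDensity_le_sqrt hp hx.1

theorem le_integral_edgeDensity {p s : ℝ} (hp : 0 ≤ p) (hs : 0 ≤ s) :
    √(1 - p * s / 4) * sqrtMass s ≤ ∫ x in (0 : ℝ)..s, edgeDensity p x := by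
  rw [← integral_sqrt_div_pi hs, ← intervalIntegral.integral_const_mul]
  refine intervalIntegral.integral_mono_on hs
    ((continuous_sqrt_div_pi.const_mul _).intervalIntegrable _ _)
    ((continuous_edgeDensity p).intervalIntegrable _ _) fun x hx => ?_
  have h1 : p * x ≤ p * s := mul_le_mul_of_nonneg_left hx.2 hp
  have h2 : √(1 - p * s / 4) ≤ √(1 - p * x / 4) := Real.sqrt_le_sqrt (by linarith)
  have h3 : 0 ≤ √x / π := by positivity
  calc _ ≤ √(1 - p * x / 4) * (√x / π) := mul_le_mul_of_nonneg_right h2 h3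
    _ = _ := by unfold edgeDensity; ring

theorem sqrtMass_le_four_mul_integral {p s : ℝ} (hp : 0 < p) (hs : 0 ≤ s) (hs' : s ≤ 4 / p) :
    sqrtMass s ≤ 4 * ∫ x in (0 : ℝ)..s, edgeDensity p x := by
  have h1 := integral_edgeDensity_mono (p := p) (show s / 2 ≤ s by linarith)
  have h2 := le_integral_edgeDensity hp.le (show 0 ≤ s / 2 by linarith)
  rw [le_div_iff₀ hp] at hs'
  have h3 : √(1 / 2) ≤ √(1 - p * (s / 2) / 4) := Real.sqrt_le_sqrt (by linarith)
  have h4 : sqrtMass s / 4 = √(1 / 2) * sqrtMass (s / 2) := by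
    unfold sqrtMass
    rw [show s / 2 = (1 / 2) * s by ring, Real.sqrt_mul (by norm_num)]
    have := Real.mul_self_sqrt (show (0 : ℝ) ≤ 1 / 2 by norm_num)
    linear_combination (-(2 / (3 * π) * (1 / 2) * s * √s)) * this
  have h5 : 0 ≤ sqrtMass (s / 2) := by unfold sqrtMass; positivity
  have := mul_le_mul_of_nonneg_right h3 h5
  linarith

theorem hasDerivAt_edge_primitive {p x : ℝ} (hp : 0 < p) (hx : 0 < x) (hx' : x < 4 / p) :
    HasDerivAt (fun y => (√y * √(1 - p * y / 4) + 2 / √p * arcsin (√p * √y / 2)) / π)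
      (edgeDensity p x / x) x := by
  have hw : 0 < 1 - p * x / 4 := by
    rw [lt_div_iff₀ hp] at hx'
    linarith
  have hsx := Real.sqrt_pos.2 hx
  have hsp := Real.sqrt_pos.2 hp
  have hsw := Real.sqrt_pos.2 hw
  have ex := Real.sq_sqrt hx.le
  have ep := Real.sq_sqrt hp.le
  have ew := Real.sq_sqrt hw.le
  have e1 : 1 - (√p * √x / 2) ^ 2 = 1 - p * x / 4 := by
    rw [div_pow, mul_pow, ex, ep]; norm_num
  have hlt : √p * √x / 2 < 1 := by nlinarith [mul_pos hsp hsx]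
  have hgt : -1 < √p * √x / 2 := by nlinarith [mul_pos hsp hsx]
  have d1 : HasDerivAt (fun y => √y) (1 / (2 * √x)) x := Real.hasDerivAt_sqrt hx.ne'
  have d2 : HasDerivAt (fun y => 1 - p * y / 4) (-(p / 4)) x := by
    have := (((hasDerivAt_id x).const_mul p).div_const 4).const_sub 1
    simpa using this
  have d3 := d2.sqrt hw.ne'
  have d4 : HasDerivAt (fun y => √p * √y / 2) (√p * (1 / (2 * √x)) / 2) x :=
    (d1.const_mul (√p)).div_const 2
  have d5 := (Real.hasDerivAt_arcsin hgt.ne' hlt.ne).comp x d4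
  have d6 := ((d1.mul d3).add (d5.const_mul (2 / √p))).div_const π
  refine d6.congr_deriv ?_
  rw [e1]
  unfold edgeDensity
  have hpi := Real.pi_pos
  generalize √(1 - p * x / 4) = w at *
  generalize √x = s at *
  generalize √p = r at *
  subst ex
  field_simp
  linear_combination -4 * ew

theorem integral_edgeDensity_div_self {p R : ℝ} (hp : 0 < p) (hR : 4 / p ≤ R) :
    IntervalIntegrable (fun x => edgeDensity p x / x) volume 0 R ∧
      ∫ x in (0 : ℝ)..R, edgeDensity p x / x = 1 / √p := by
  have h4 : (0 : ℝ) < 4 / p := by positivity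
  have hc : Continuous fun y => (√y * √(1 - p * y / 4) + 2 / √p * arcsin (√p * √y / 2)) / π := by
    fun_prop
  have i1 : IntervalIntegrable (fun x => edgeDensity p x / x) volume 0 (4 / p) := by
    refine intervalIntegral.intervalIntegrable_deriv_of_nonneg hc.continuousOn (fun x hx => ?_)
      (fun x hx => ?_)
    · simp only [h4.le, min_eq_left, max_eq_right] at hx
      exact hasDerivAt_edge_primitive hp hx.1 hx.2
    · simp only [h4.le, min_eq_left, max_eq_right] at hx
      exact div_nonneg (edgeDensity_nonneg _ _) hx.1.le
  have hz : Set.EqOn (fun x => edgeDensity p x / x) (fun _ => (0 : ℝ)) (Set.uIcc (4 / p) R) := by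
    intro x hx
    rw [Set.uIcc_of_le hR] at hx
    simp [edgeDensity_of_le hp hx.1]
  have i2 : IntervalIntegrable (fun x => edgeDensity p x / x) volume (4 / p) R :=
    (intervalIntegrable_const (c := (0 : ℝ))).congr
      (fun x hx => (hz (Set.uIoc_subset_uIcc hx)).symm)
  refine ⟨i1.trans i2, ?_⟩
  rw [← intervalIntegral.integral_add_adjacent_intervals i1 i2,
    intervalIntegral.integral_congr hz,
    intervalIntegral.integral_eq_sub_of_hasDerivAt_of_le h4.le hc.continuousOn
      (fun x hx => hasDerivAt_edge_primitive hp hx.1 hx.2) i1]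
  have e : √p * √(4 / p) / 2 = 1 := by
    rw [← Real.sqrt_mul hp.le, mul_div_cancel₀ _ hp.ne', show (4 : ℝ) = 2 ^ 2 by norm_num,
      Real.sqrt_sq (by norm_num)]
    norm_num
  have e2 : 1 - p * (4 / p) / 4 = 0 := by field_simp; norm_num
  simp only [e, e2]
  have := Real.pi_pos
  have := Real.sqrt_pos.2 hp
  simp
  field_simp

theorem edge_quantile_gap {p q k A L : ℝ} (hp : 0 < p) (hq : 0 ≤ q) (hk : 2 ≤ k)
    (hpk : p ^ 3 * k ^ 5 ≤ 8) (hL : 0 < L) (hLk : ∫ x in (0 : ℝ)..L, edgeDensity q x = k)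
    (hA : ∫ x in (0 : ℝ)..A, edgeDensity p x ≤ k - 1) :
    A ≤ (1 - 1 / (50 * k)) * L := by
  have hpi := Real.pi_pos
  have hk0 : 0 < k := by linarith
  obtain ⟨s, hs, hs1⟩ : ∃ s : ℝ, 0 < s ∧ s ^ 3 = (3 * π * k / 2) ^ 2 := by
    refine ⟨(3 * π * k / 2) ^ ((2 : ℝ) / 3), by positivity, ?_⟩
    rw [← Real.rpow_natCast, ← Real.rpow_mul (by positivity), ← Real.rpow_natCast]
    norm_num
  have hmass : ∀ x, 0 ≤ x → sqrtMass x = 2 / (3 * π) * √(x ^ 3) := by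
    intro x hx
    rw [sqrtMass, show x ^ 3 = x ^ 2 * x by ring, Real.sqrt_mul (by positivity), Real.sqrt_sq hx]
  have hms : sqrtMass s = k := by
    rw [hmass s hs.le, hs1, Real.sqrt_sq (by positivity)]
    field_simp
  have hsL : s ≤ L := by
    by_contra! h
    have h1 := integral_edgeDensity_le hq hL.le
    have h2 : sqrtMass L < sqrtMass s := by
      unfold sqrtMass
      have := Real.sqrt_pos.2 hL
      gcongr
    linarith
  set θ := 1 - 1 / (50 * k) with hθ
  have hθk : θ * k = k - 1 / 50 := by
    rw [hθ]; field_simp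
  have hθ0 : 0 < θ := by
    by_contra! h
    nlinarith
  have hθ1 : θ ≤ 1 := by
    have : 0 < 1 / (50 * k) := by positivity
    linarith
  by_contra! h
  have hA' : θ * s ≤ A := (mul_le_mul_of_nonneg_left hsL hθ0.le).trans h.le
  have h1 := integral_edgeDensity_mono (p := p) hA'
  have h2 := le_integral_edgeDensity hp.le (mul_pos hθ0 hs).le
  obtain ⟨u, hu⟩ : ∃ u, u = p * s / 4 := ⟨_, rfl⟩
  have hu0 : 0 < u := by rw [hu]; positivity
  have huk : u * k < 1.41 := by
    have e : (u * k) ^ 3 = p ^ 3 * k ^ 5 * (9 * π ^ 2 / 256) := by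
      have : (u * k) ^ 3 = p ^ 3 * k ^ 3 / 64 * s ^ 3 := by rw [hu]; ring
      rw [this, hs1]; ring
    have hpi2 : π ^ 2 < 9.87 := by
      have := Real.pi_lt_d4
      nlinarith
    have : (u * k) ^ 3 < 1.41 ^ 3 := by
      rw [e]
      nlinarith [mul_le_mul_of_nonneg_right hpk (show 0 ≤ 9 * π ^ 2 / 256 by positivity)]
    exact lt_of_pow_lt_pow_left₀ 3 (by norm_num) this
  have hmθ : sqrtMass (θ * s) = √(θ ^ 3) * k := by
    rw [hmass _ (by positivity), mul_pow, Real.sqrt_mul (by positivity), ← hms, hmass s hs.le]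
    ring
  have hθ3 : (k - 3 / 50) ≤ θ ^ 3 * k := by
    have e : θ ^ 3 * k = θ * θ * (k - 1 / 50) := by rw [← hθk]; ring
    have e2 : θ * θ * k = θ * (k - 1 / 50) := by rw [← hθk]; ring
    nlinarith
  have h3 : (k - 1) ^ 2 < (√(1 - p * (θ * s) / 4) * (√(θ ^ 3) * k)) ^ 2 := by
    have hw : 1 - u ≤ 1 - p * (θ * s) / 4 := by
      have : u * θ ≤ u := by nlinarith
      have : p * (θ * s) / 4 = u * θ := by rw [hu]; ring
      linarith
    have hu1 : 0 < 1 - u := by nlinarith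
    rw [mul_pow, mul_pow, Real.sq_sqrt (hu1.le.trans hw), Real.sq_sqrt (by positivity)]
    calc (k - 1) ^ 2 < (1 - u) * k * (k - 3 / 50) := by nlinarith
      _ ≤ (1 - u) * k * (θ ^ 3 * k) := mul_le_mul_of_nonneg_left hθ3 (by positivity)
      _ = (1 - u) * (θ ^ 3 * k ^ 2) := by ring
      _ ≤ _ := mul_le_mul_of_nonneg_right hw (by positivity)
  rw [hmθ] at h2
  have := lt_of_pow_lt_pow_left₀ 2 (by positivity) h3
  linarith

theorem edge_quantile_anti {p q k L L' : ℝ} (hq : 0 < q) (hqp : q ≤ p) (hk : 0 < k)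
    (hLq : L' ≤ 4 / q) (hL : ∫ x in (0 : ℝ)..L, edgeDensity p x = k)
    (hL' : ∫ x in (0 : ℝ)..L', edgeDensity q x = k) : L' ≤ L := by
  by_contra! h
  have hL0 : 0 < L := by
    by_contra! h0
    rw [integral_edgeDensity_of_nonpos p h0] at hL
    exact hk.ne hL
  have h1 := integral_edgeDensity_anti hqp hL0.le
  have h2 := intervalIntegral.integral_add_adjacent_intervals
    ((continuous_edgeDensity q).intervalIntegrable (μ := volume) 0 L)
    ((continuous_edgeDensity q).intervalIntegrable (μ := volume) L L')
  have h3 : 0 < ∫ x in L..L', edgeDensity q x :=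
    intervalIntegral.intervalIntegral_pos_of_pos_on
      ((continuous_edgeDensity q).intervalIntegrable _ _)
      (fun x hx => edgeDensity_pos hq (hL0.trans hx.1) (hx.2.trans_le hLq)) h
  linarith

theorem one_le_of_one_le_sqrtMass {s : ℝ} (h : 1 ≤ sqrtMass s) : 1 ≤ s := by
  by_contra! hs
  have h1 : √s ≤ 1 := Real.sqrt_le_one.2 hs.le
  have h2 : s * √s ≤ 1 := by nlinarith [Real.sqrt_nonneg s]
  have h3 : 2 / (3 * π) < 1 := by
    rw [div_lt_one (by positivity)]
    linarith [Real.pi_gt_three]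
  have h4 : 0 < 2 / (3 * π) := by positivity
  unfold sqrtMass at h
  nlinarith

theorem abs_div_sub_le {a x L κ : ℝ} (hL : 0 < L) (hκ : 1 ≤ κ) (ha : |a| ≤ (1 - 1 / κ) * L)
    (hx : L ≤ x) : |a / (a - x)| ≤ κ ∧ |a / (a - x)| ≤ |a| / x + a ^ 2 * κ / x ^ 2 := by
  have hx0 : 0 < x := hL.trans_le hx
  have hκ0 : 0 < κ := by linarith
  have h0 : 0 ≤ 1 - 1 / κ := by
    rw [sub_nonneg, div_le_one hκ0]; exact hκ
  have h1 : |a| ≤ (1 - 1 / κ) * x := ha.trans (mul_le_mul_of_nonneg_left hx h0)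
  have h2 : x ≤ κ * (x - |a|) := by
    have : κ * ((1 - 1 / κ) * x) = κ * x - x := by field_simp
    nlinarith [mul_le_mul_of_nonneg_left h1 hκ0.le]
  have h3 : 0 < x - |a| := by
    by_contra! h
    nlinarith
  have h4 : |a / (a - x)| ≤ |a| / (x - |a|) := by
    rw [abs_div]
    have : x - |a| ≤ |a - x| := by
      rw [abs_sub_comm]
      have := abs_sub_abs_le_abs_sub x a
      rwa [abs_of_pos hx0] at this
    gcongr
  have hax : |a| ≤ x := by linarith
  constructor
  · refine h4.trans ?_
    rw [div_le_iff₀ h3]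
    linarith
  · refine h4.trans ?_
    rw [← sq_abs a, div_add_div _ _ hx0.ne' (by positivity), div_le_div_iff₀ h3 (by positivity)]
    have := mul_le_mul_of_nonneg_left h2 (show 0 ≤ |a| ^ 2 * x by positivity)
    nlinarith [abs_nonneg a]

theorem integral_edgeDensity_sub_le {p q s : ℝ} (hp : 0 ≤ p) (hq : 0 ≤ q) (hs : 0 ≤ s) :
    (∫ x in (0 : ℝ)..s, edgeDensity q x) - ∫ x in (0 : ℝ)..s, edgeDensity p x ≤
      p * s / 4 * sqrtMass s := by
  have cp := continuous_edgeDensity p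
  have cq := continuous_edgeDensity q
  rw [← intervalIntegral.integral_sub (cq.intervalIntegrable _ _) (cp.intervalIntegrable _ _),
    ← integral_sqrt_div_pi hs, ← intervalIntegral.integral_const_mul]
  refine intervalIntegral.integral_mono_on hs ((cq.sub cp).intervalIntegrable _ _)
    ((continuous_sqrt_div_pi.const_mul _).intervalIntegrable _ _) fun x hx => ?_
  refine (edgeDensity_sub_le hp hq hx.1).trans ?_
  have := mul_le_mul_of_nonneg_left hx.2 hp
  have : 0 ≤ √x / π := by positivity
  gcongr

theorem abs_integral_edgeDensity_div_sub_le {p q s : ℝ} (hq : 0 < q) (hqp : q ≤ p) (hs : 0 ≤ s)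
    (ip : IntervalIntegrable (fun x => edgeDensity p x / x) volume 0 s)
    (iq : IntervalIntegrable (fun x => edgeDensity q x / x) volume 0 s) :
    |(∫ x in (0 : ℝ)..s, edgeDensity p x / x) - ∫ x in (0 : ℝ)..s, edgeDensity q x / x| ≤
      p / 4 * sqrtMass s := by
  have hp := hq.trans_le hqp
  rw [← intervalIntegral.integral_sub ip iq, ← integral_sqrt_div_pi hs,
    ← intervalIntegral.integral_const_mul, ← Real.norm_eq_abs]
  refine intervalIntegral.norm_integral_le_of_norm_le hs (.of_forall fun x hx => ?_)
    ((continuous_sqrt_div_pi.const_mul _).intervalIntegrable _ _)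
  have h1 := edgeDensity_sub_le hp.le hq.le hx.1.le
  have h2 := edgeDensity_anti hqp hx.1.le
  rw [Real.norm_eq_abs, ← sub_div, abs_div, abs_of_pos hx.1, abs_of_nonpos (by linarith),
    div_le_iff₀ hx.1]
  linarith

theorem integral_edgeDensity_div_sub {p a L R : ℝ} (hp : 0 < p) (hL : 0 < L) (ha : a < L)
    (hLR : L ≤ R) (hR : 4 / p ≤ R) :
    (∫ x in L..R, edgeDensity p x / (a - x)) + 1 / √p =
      (∫ x in L..R, edgeDensity p x / x * (a / (a - x))) +
        ∫ x in (0 : ℝ)..L, edgeDensity p x / x := by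
  obtain ⟨i, e⟩ := integral_edgeDensity_div_self hp hR
  have hc : ContinuousOn (edgeDensity p) (Set.uIcc L R) := (continuous_edgeDensity p).continuousOn
  have h0 : ∀ x ∈ Set.uIcc L R, x ≠ 0 ∧ a - x ≠ 0 := fun x hx => by
    rw [Set.uIcc_of_le hLR] at hx
    exact ⟨by linarith [hx.1], by linarith [hx.1]⟩
  have i1 : IntervalIntegrable (fun x => edgeDensity p x / x) volume 0 L :=
    i.mono_set (Set.uIcc_subset_uIcc_left (by rw [Set.uIcc_of_le] <;> grind))
  have i2 : IntervalIntegrable (fun x => edgeDensity p x / x) volume L R :=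
    (hc.div continuousOn_id fun x hx => (h0 x hx).1).intervalIntegrable
  have i3 : IntervalIntegrable (fun x => edgeDensity p x / (a - x)) volume L R :=
    (hc.div (by fun_prop) fun x hx => (h0 x hx).2).intervalIntegrable
  rw [← e, ← intervalIntegral.integral_add_adjacent_intervals i1 i2, add_comm (∫ x in (0 : ℝ)..L, _),
    ← add_assoc, ← intervalIntegral.integral_add i3 i2]
  congr 1
  refine intervalIntegral.integral_congr fun x hx => ?_
  obtain ⟨h1, h2⟩ := h0 x hx
  field_simp
  ring

theorem integral_inv_sqrt_le {b c L R : ℝ} (hL : 0 < L) (hLR : L ≤ R) (hc : 0 ≤ c) :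
    IntervalIntegrable (fun x => √x * (b / x + c / x ^ 2)) volume L R ∧
    ∫ x in L..R, √x * (b / x + c / x ^ 2) ≤ 2 * b * √R - 2 * b * √L + 2 * c / √L := by
  have i : IntervalIntegrable (fun x => √x * (b / x + c / x ^ 2)) volume L R := by
    refine ContinuousOn.intervalIntegrable ?_
    rw [Set.uIcc_of_le hLR]
    refine (by fun_prop : Continuous fun x : ℝ => √x).continuousOn.mul (ContinuousOn.add ?_ ?_)
    · exact continuousOn_const.div continuousOn_id fun x hx => (hL.trans_le hx.1).ne'
    · exact continuousOn_const.div (by fun_prop) fun x hx => (pow_pos (hL.trans_le hx.1) 2).ne'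
  refine ⟨i, ?_⟩
  rw [intervalIntegral.integral_eq_sub_of_hasDerivAt (f := fun x => 2 * b * √x - 2 * c / √x) ?_ i]
  · have : 0 ≤ 2 * c / √R := by positivity
    linarith
  · intro x hx
    rw [Set.uIcc_of_le hLR] at hx
    have hx0 := hL.trans_le hx.1
    have hs := Real.sqrt_pos.2 hx0
    have d := Real.hasDerivAt_sqrt hx0.ne'
    refine ((d.const_mul (2 * b)).sub ((hasDerivAt_const x (2 * c)).div d hs.ne')).congr_deriv ?_
    have ex := Real.sq_sqrt hx0.le
    generalize √x = s at *
    subst ex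
    field_simp
    ring

theorem mul_sqrt_eq_sqrtMass (s : ℝ) : s * √s = 3 * π / 2 * sqrtMass s := by
  unfold sqrtMass
  have := Real.pi_pos
  field_simp

theorem intervalIntegrable_edgeDensity_kernel (p : ℝ) {a L s t : ℝ} (hL : 0 < L) (ha : a < L)
    (hs : L ≤ s) (ht : L ≤ t) :
    IntervalIntegrable (fun x => edgeDensity p x / x * (a / (a - x))) volume s t := by
  have h : ∀ x ∈ Set.uIcc s t, L ≤ x := fun x hx => (le_min hs ht).trans hx.1
  refine ContinuousOn.intervalIntegrable (ContinuousOn.mul ?_ ?_)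
  · exact (continuous_edgeDensity p).continuousOn.div continuousOn_id
      fun x hx => (hL.trans_le (h x hx)).ne'
  · exact continuousOn_const.div (by fun_prop) fun x hx => by linarith [h x hx]

theorem abs_integral_one_sub_kernel_le {p a κ L L' : ℝ} (hL' : 0 < L') (hLL : L' ≤ L)
    (hκ : 1 ≤ κ) (ha : |a| ≤ (1 - 1 / κ) * L') :
    |∫ x in L'..L, (edgeDensity p x / x - edgeDensity p x / x * (a / (a - x)))| ≤
      (1 + κ) / L' * ∫ x in L'..L, edgeDensity p x := by
  rw [← intervalIntegral.integral_const_mul, ← Real.norm_eq_abs]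
  refine intervalIntegral.norm_integral_le_of_norm_le hLL (.of_forall fun x hx => ?_)
    (((continuous_edgeDensity p).const_mul _).intervalIntegrable _ _)
  have hx0 := hL'.trans hx.1
  have h1 := (abs_div_sub_le hL' hκ ha hx.1.le).1
  have h2 : |1 - a / (a - x)| ≤ 1 + κ := (abs_sub _ _).trans (by rw [abs_one]; linarith)
  have h3 := edgeDensity_nonneg p x
  rw [Real.norm_eq_abs, ← mul_one_sub, abs_mul, abs_of_nonneg (by positivity)]
  calc _ ≤ edgeDensity p x / L' * (1 + κ) := by gcongr; exact hx.1.le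
    _ = _ := by ring

theorem abs_integral_kernel_sub_le {p q a κ L R : ℝ} (hq : 0 < q) (hqp : q ≤ p) (hL : 0 < L)
    (hLR : L ≤ R) (hκ : 1 ≤ κ) (ha : |a| ≤ (1 - 1 / κ) * L) :
    |∫ x in L..R, (edgeDensity p x / x * (a / (a - x)) - edgeDensity q x / x * (a / (a - x)))| ≤
      p / (4 * π) * (2 * L * √R + 2 * κ * (L * √L)) := by
  have hp := hq.trans_le hqp
  have hpi := Real.pi_pos
  have haL : |a| ≤ L := by
    have : 0 < 1 / κ := by positivity
    nlinarith
  obtain ⟨i, hF⟩ := integral_inv_sqrt_le (b := |a|) (c := a ^ 2 * κ) hL hLR (by positivity)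
  have h : |∫ x in L..R, (edgeDensity p x / x * (a / (a - x)) -
      edgeDensity q x / x * (a / (a - x)))| ≤
      p / (4 * π) * ∫ x in L..R, √x * (|a| / x + a ^ 2 * κ / x ^ 2) := by
    rw [← intervalIntegral.integral_const_mul, ← Real.norm_eq_abs]
    refine intervalIntegral.norm_integral_le_of_norm_le hLR (.of_forall fun x hx => ?_)
      (i.const_mul _)
    have hx0 := hL.trans hx.1
    have h1 := (abs_div_sub_le hL hκ ha hx.1.le).2
    have h2 := edgeDensity_sub_le hp.le hq.le hx0.le
    have h3 := edgeDensity_anti hqp hx0.le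
    have h4 : |edgeDensity p x / x - edgeDensity q x / x| ≤ p / (4 * π) * √x := by
      rw [← sub_div, abs_div, abs_of_pos hx0, abs_of_nonpos (by linarith), div_le_iff₀ hx0]
      calc _ ≤ _ := by linarith
        _ ≤ _ := h2
        _ = _ := by field_simp
    rw [Real.norm_eq_abs, ← sub_mul, abs_mul, ← mul_assoc]
    exact mul_le_mul h4 h1 (abs_nonneg _) (by positivity)
  refine h.trans (mul_le_mul_of_nonneg_left (hF.trans ?_) (by positivity))
  have hs := Real.sqrt_pos.2 hL
  have h1 : 2 * (a ^ 2 * κ) / √L ≤ 2 * κ * (L * √L) := by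
    rw [div_le_iff₀ hs]
    have e : L ^ 2 = L * √L * √L := by rw [mul_assoc, Real.mul_self_sqrt hL.le]; ring
    have : a ^ 2 ≤ L ^ 2 := by rw [← sq_abs]; gcongr
    calc 2 * (a ^ 2 * κ) ≤ 2 * (L ^ 2 * κ) := by gcongr
      _ = _ := by rw [e]; ring
  have h2 : 2 * |a| * √R ≤ 2 * L * √R := by gcongr
  have h3 : 0 ≤ 2 * |a| * √L := by positivity
  linarith

theorem abs_edge_integral_sub_le {p q k a κ L L' : ℝ} (hq : 0 < q) (hqp : q ≤ p) (hk : 0 < k)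
    (hκ : 1 ≤ κ) (hL'0 : 0 < L') (hLp : L ≤ 4 / p) (hLq : L' ≤ 4 / q)
    (hL : ∫ x in (0 : ℝ)..L, edgeDensity p x = k)
    (hL' : ∫ x in (0 : ℝ)..L', edgeDensity q x = k) (ha : |a| ≤ (1 - 1 / κ) * L') :
    |(∫ x in L..(4 / q), edgeDensity p x / (a - x)) + 1 / √p - 1 / √q -
      ∫ x in L'..(4 / q), edgeDensity q x / (a - x)| ≤
      p / (4 * π) * (2 * L' * √(4 / q) + 2 * κ * (L' * √L')) +
        (2 + κ) * (p / 4 * sqrtMass L') := by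
  have hp := hq.trans_le hqp
  have hpR : 4 / p ≤ 4 / q := by gcongr
  have hLL : L' ≤ L := edge_quantile_anti hq hqp hk hLq hL hL'
  have hLR : L ≤ 4 / q := hLp.trans hpR
  have haL : a < L' := by
    have : 0 < 1 / κ := by positivity
    nlinarith [le_abs_self a]
  obtain ⟨ip, -⟩ := integral_edgeDensity_div_self hp hpR
  obtain ⟨iq, -⟩ := integral_edgeDensity_div_self hq le_rfl
  have hmem : ∀ s, 0 ≤ s → s ≤ 4 / q → s ∈ Set.uIcc 0 (4 / q) := fun s h0 hs => by
    rw [Set.uIcc_of_le (h0.trans hs)]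
    exact ⟨h0, hs⟩
  have hL'm := hmem L' hL'0.le hLq
  have iu := ip.mono_set (Set.uIcc_subset_uIcc hL'm (hmem L (hL'0.le.trans hLL) hLR))
  have ip' := ip.mono_set (Set.uIcc_subset_uIcc_left hL'm)
  have iq' := iq.mono_set (Set.uIcc_subset_uIcc_left hL'm)
  have iw := fun r s t => intervalIntegrable_edgeDensity_kernel r hL'0 haL (s := s) (t := t)
  have X := integral_edgeDensity_div_sub hp (hL'0.trans_le hLL) (haL.trans_le hLL) hLR hpR
  have Y := integral_edgeDensity_div_sub hq hL'0 haL hLq le_rfl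
  have Z1 := intervalIntegral.integral_add_adjacent_intervals (iw p L' L le_rfl hLL)
    (iw p L (4 / q) hLL hLq)
  have Z2 := intervalIntegral.integral_add_adjacent_intervals ip' iu
  have Z3 := intervalIntegral.integral_sub (iw p L' (4 / q) le_rfl hLq)
    (iw q L' (4 / q) le_rfl hLq)
  have Z4 := intervalIntegral.integral_sub iu (iw p L' L le_rfl hLL)
  have B1 := abs_integral_kernel_sub_le hq hqp hL'0 hLq hκ ha
  have B2 := abs_integral_one_sub_kernel_le (p := p) hL'0 hLL hκ ha
  have B3 := abs_integral_edgeDensity_div_sub_le hq hqp hL'0.le ip' iq'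
  have hmass : ∫ x in L'..L, edgeDensity p x ≤ p * L' / 4 * sqrtMass L' := by
    have h1 := intervalIntegral.integral_add_adjacent_intervals
      ((continuous_edgeDensity p).intervalIntegrable (μ := volume) 0 L')
      ((continuous_edgeDensity p).intervalIntegrable (μ := volume) L' L)
    have h2 := integral_edgeDensity_sub_le hp.le hq.le hL'0.le
    linarith
  have B4 : (1 + κ) / L' * ∫ x in L'..L, edgeDensity p x ≤ (1 + κ) * (p / 4 * sqrtMass L') :=
    calc _ ≤ (1 + κ) / L' * (p * L' / 4 * sqrtMass L') := by gcongr
      _ = _ := by field_simp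
  have key : (∫ x in L..(4 / q), edgeDensity p x / (a - x)) + 1 / √p - 1 / √q -
      (∫ x in L'..(4 / q), edgeDensity q x / (a - x)) =
      (∫ x in L'..(4 / q),
        (edgeDensity p x / x * (a / (a - x)) - edgeDensity q x / x * (a / (a - x)))) +
      (∫ x in L'..L, (edgeDensity p x / x - edgeDensity p x / x * (a / (a - x)))) +
      ((∫ x in (0 : ℝ)..L', edgeDensity p x / x) - ∫ x in (0 : ℝ)..L', edgeDensity q x / x) := by
    linarith
  rw [key]
  refine (abs_add_three _ _ _).trans ?_
  linarith

theorem edge_integral_comparison {p q k a L L' : ℝ} (hq : 0 < q) (hqp : q ≤ p) (hpq : p ≤ 5 * q)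
    (hk : 1 ≤ k) (hL'0 : 0 < L') (hLp : L ≤ 4 / p) (hLq : L' ≤ 4 / q)
    (hL : ∫ x in (0 : ℝ)..L, edgeDensity p x = k)
    (hL' : ∫ x in (0 : ℝ)..L', edgeDensity q x = k) (ha : |a| ≤ (1 - 1 / (50 * k)) * L') :
    |(∫ x in L..(4 / q), edgeDensity p x / (a - x)) + 1 / √p - 1 / √q -
      ∫ x in L'..(4 / q), edgeDensity q x / (a - x)| ≤ 15 * k * √p + 202 * k ^ 2 * p := by
  have hp := hq.trans_le hqp
  have hpi := Real.pi_pos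
  have hk0 : 0 < k := by linarith
  refine (abs_edge_integral_sub_le hq hqp hk0 (by linarith) hL'0 hLp hLq hL hL' ha).trans ?_
  have hm : sqrtMass L' ≤ 4 * k := hL' ▸ sqrtMass_le_four_mul_integral hq hL'0.le hLq
  have hs1 : 1 ≤ √L' := Real.one_le_sqrt.2 <| one_le_of_one_le_sqrtMass <|
    hk.trans (hL' ▸ integral_edgeDensity_le hq.le hL'0.le)
  have hLs : L' * √L' ≤ 6 * π * k := by
    rw [mul_sqrt_eq_sqrtMass]
    calc _ ≤ 3 * π / 2 * (4 * k) := by gcongr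
      _ = _ := by ring
  have hLk : L' ≤ 6 * π * k := (le_mul_of_one_le_right hL'0.le hs1).trans hLs
  have hsR : √p * √(4 / q) ≤ 5 := by
    rw [← Real.sqrt_mul hp.le, Real.sqrt_le_left (by norm_num), ← mul_div_assoc, div_le_iff₀ hq]
    linarith
  have e1 : p / (4 * π) * (2 * (6 * π * k) * √(4 / q)) = 3 * k * √p * (√p * √(4 / q)) := by
    have := Real.mul_self_sqrt hp.le
    generalize √(4 / q) = R
    field_simp
    linear_combination (-12 * R) * this
  have e2 : 2 * L' * √(4 / q) ≤ 2 * (6 * π * k) * √(4 / q) := by gcongr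
  calc _ ≤ p / (4 * π) * (2 * (6 * π * k) * √(4 / q) + 2 * (50 * k) * (6 * π * k)) +
        (2 + 50 * k) * (p / 4 * (4 * k)) := by gcongr
    _ = 3 * k * √p * (√p * √(4 / q)) + 150 * k ^ 2 * p + (2 + 50 * k) * k * p := by
      rw [mul_add, e1]
      field_simp
      ring
    _ ≤ 3 * k * √p * 5 + 150 * k ^ 2 * p + (2 * k + 50 * k) * k * p := by
      gcongr
      linarith
    _ = _ := by ring

theorem setIntegral_Ioi_edgeDensity {p a L R : ℝ} (hp : 0 < p) (hR : 4 / p ≤ R) :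
    ∫ x in Set.Ioi L, edgeDensity p x / (a - x) =
      ∫ x in (min L (4 / p))..R, edgeDensity p x / (a - x) := by
  have hz : ∀ x, 4 / p ≤ x → edgeDensity p x / (a - x) = 0 := fun x hx => by
    rw [edgeDensity_of_le hp hx, zero_div]
  rw [intervalIntegral.integral_of_le ((min_le_right _ _).trans hR),
    ← setIntegral_eq_of_subset_of_forall_sdiff_eq_zero (t := Set.Ioi (min L (4 / p)))
      (s := Set.Ioi L) measurableSet_Ioi (Set.Ioi_subset_Ioi (min_le_left _ _)),
    setIntegral_eq_of_subset_of_forall_sdiff_eq_zero (s := Set.Ioc (min L (4 / p)) R)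
      measurableSet_Ioi (fun x hx => hx.1)]
  · rintro x ⟨h1, h2⟩
    refine hz x (hR.trans ?_)
    by_contra! h
    exact h2 ⟨h1, h.le⟩
  · rintro x ⟨h1, h2⟩
    rw [Set.mem_Ioi, min_lt_iff] at h1
    exact hz x (h1.resolve_left h2).le

theorem integral_edgeDensity_quantile {n : ℕ} (hn : 0 < n) {k γ : ℝ}
    (h : k / n = ∫ E in (-2 : ℝ)..γ, semicircle E) :
    ∫ x in (0 : ℝ)..(n : ℝ) ^ ((2 : ℝ) / 3) * (γ + 2),
      edgeDensity ((n : ℝ) ^ (-(2 : ℝ) / 3)) x = k := by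
  have hn' : (0 : ℝ) < n := by exact_mod_cast hn
  have hp : 0 < (n : ℝ) ^ (-(2 : ℝ) / 3) := by positivity
  have e1 : (n : ℝ) ^ (-(2 : ℝ) / 3) * ((n : ℝ) ^ ((2 : ℝ) / 3) * (γ + 2)) - 2 = γ := by
    rw [← mul_assoc, ← Real.rpow_add hn']
    norm_num
  have e2 : (n : ℝ) ^ (-(2 : ℝ) / 3) * √((n : ℝ) ^ (-(2 : ℝ) / 3)) * n = 1 := by
    rw [sqrt_rpow_neg_two_thirds hn', ← Real.rpow_add hn', ← Real.rpow_add_one hn'.ne']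
    norm_num
  have h1 := intervalIntegral.mul_integral_comp_mul_sub (f := semicircle)
    ((n : ℝ) ^ (-(2 : ℝ) / 3)) 2 (a := 0) (b := (n : ℝ) ^ ((2 : ℝ) / 3) * (γ + 2))
  rw [e1, mul_zero, zero_sub, ← h] at h1
  simp_rw [semicircle_edge hp] at h1
  rw [intervalIntegral.integral_const_mul, eq_div_iff hn'.ne'] at h1
  linear_combination h1 - (∫ x in (0 : ℝ)..(n : ℝ) ^ ((2 : ℝ) / 3) * (γ + 2),
      edgeDensity ((n : ℝ) ^ (-(2 : ℝ) / 3)) x) * e2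

theorem edge_index_bounds {ω δ K : ℝ} {N : ℕ} (hω1 : 0 < ω) (hω2 : ω < 1 / 10) (hδ1 : 0 < δ)
    (hδ2 : δ < 1) (hN : 2 ≤ N) (hK : K = (N : ℝ) ^ ω) :
    1 ≤ ⌊K⌋₊ ∧ ⌊K⌋₊ + 1 ≤ ⌊K + K ^ δ⌋₊ ∧ 1 ≤ ⌊K + K ^ δ - K ^ (δ / 2)⌋₊ ∧
      ⌊K + K ^ δ - K ^ (δ / 2)⌋₊ + 1 ≤ ⌊K + K ^ δ⌋₊ ∧ ⌊K + K ^ δ⌋₊ ≤ N ∧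
      ⌊K + K ^ δ⌋₊ ^ 5 ≤ 8 * N ^ 2 ∧ (⌊K + K ^ δ⌋₊ : ℝ) ≤ 2 * K ∧ 1 ≤ K ∧
      K ≤ (N : ℝ) ^ ((1 : ℝ) / 3) := by
  have hN1 : (1 : ℝ) ≤ N := by exact_mod_cast (by omega : 1 ≤ N)
  have hK1 : 1 ≤ K := hK ▸ Real.one_le_rpow hN1 hω1.le
  have hK10 : K ^ 10 ≤ N := by
    rw [hK, ← Real.rpow_natCast, ← Real.rpow_mul (by linarith)]
    calc _ ≤ (N : ℝ) ^ (1 : ℝ) := Real.rpow_le_rpow_of_exponent_le hN1 (by norm_num; linarith)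
      _ = _ := Real.rpow_one _
  have hKδ1 : 1 ≤ K ^ (δ / 2) := Real.one_le_rpow hK1 (by linarith)
  have hKδ : K ^ δ ≤ K := by
    simpa using Real.rpow_le_rpow_of_exponent_le hK1 hδ2.le
  have hKδ2 : K ^ (δ / 2) * K ^ (δ / 2) = K ^ δ := by
    rw [← Real.rpow_add (by linarith)]; norm_num
  have hKδ3 : K ^ (δ / 2) ≤ K ^ δ := by nlinarith
  have hk2 : (⌊K + K ^ δ⌋₊ : ℝ) ≤ 2 * K := (Nat.floor_le (by positivity)).trans (by linarith)
  have step : ∀ x y : ℝ, 0 ≤ x → x + 1 ≤ y → ⌊x⌋₊ + 1 ≤ ⌊y⌋₊ := fun x y hx hxy => by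
    rw [← Nat.floor_add_one hx]
    exact Nat.floor_le_floor hxy
  have h10 : ⌊K + K ^ δ⌋₊ ^ 10 ≤ 1024 * N := by
    have : (⌊K + K ^ δ⌋₊ : ℝ) ^ 10 ≤ (2 * K) ^ 10 := by gcongr
    have h' : (⌊K + K ^ δ⌋₊ : ℝ) ^ 10 ≤ 1024 * N := by
      rw [mul_pow] at this
      linarith
    exact_mod_cast h'
  have hk1 : 1 ≤ ⌊K⌋₊ := Nat.one_le_floor_iff _ |>.2 hK1
  refine ⟨hk1, step _ _ (by linarith) (by linarith), Nat.one_le_floor_iff _ |>.2 (by linarith),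
    step _ _ (by linarith) (by linarith), ?_, ?_, hk2, hK1, ?_⟩
  · generalize ⌊K + K ^ δ⌋₊ = k at *
    by_contra! h
    have h1 : k * k ^ 9 ≤ k * 1024 := by
      calc k * k ^ 9 = k ^ 10 := by ring
        _ ≤ 1024 * N := h10
        _ ≤ k * 1024 := by omega
    have h2 := Nat.le_of_mul_le_mul_left h1 (by omega)
    have h3 := Nat.pow_le_pow_left (show 3 ≤ k by omega) 9
    omega
  · generalize ⌊K + K ^ δ⌋₊ = k at *
    rcases le_or_gt k 2 with h | h
    · have h1 := Nat.pow_le_pow_left h 5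
      have h2 := Nat.pow_le_pow_left hN 2
      omega
    · have h3 := Nat.pow_le_pow_left (show 3 ≤ k by omega) 10
      have h4 : 3 ≤ N := by omega
      have h5 := Nat.pow_le_pow_left h4 3
      have : (k ^ 5) ^ 2 ≤ (8 * N ^ 2) ^ 2 := by
        calc (k ^ 5) ^ 2 = k ^ 10 := by ring
          _ ≤ 1024 * N := h10
          _ ≤ 64 * N ^ 3 * N := Nat.mul_le_mul_right _ (by omega)
          _ = _ := by ring
      exact (Nat.pow_le_pow_iff_left (by norm_num)).1 this
  · rw [hK]
    exact Real.rpow_le_rpow_of_exponent_le hN1 (by linarith)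

/-- Comparison of the `x`- and `y`-mean-field terms (Lemma 3.4). -/
theorem mean_field_comparison (ωK δc : ℝ) (hω1 : 0 < ωK) (hω2 : ωK < 1 / 10)
    (hδ1 : 0 < δc) (hδ2 : δc < 1 / 1000) :
    ∃ C : ℝ, 0 < C ∧
      ∀ N M : ℕ, 2 ≤ N → N ≤ M → M ≤ 10 * N →
      ∀ γN γM : ℕ → ℝ,
        (∀ k : ℕ, 1 ≤ k → k ≤ N → (k : ℝ) / N = ∫ E in (-2 : ℝ)..(γN k), semicircle E) →
        (∀ k : ℕ, 1 ≤ k → k ≤ M → (k : ℝ) / M = ∫ E in (-2 : ℝ)..(γM k), semicircle E) →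
      ∀ K : ℝ, K = (N : ℝ) ^ ωK →
      ∀ a : ℝ,
        -((N : ℝ) ^ ((2 : ℝ) / 3) * (γN ⌊K⌋₊ + 2)) ≤ a →
        a ≤ (N : ℝ) ^ ((2 : ℝ) / 3) * (γN ⌊K + K ^ δc - K ^ (δc / 2)⌋₊ + 2) →
        |(∫ x in Set.Ioi ((N : ℝ) ^ ((2 : ℝ) / 3) * (γN ⌊K + K ^ δc⌋₊ + 2)),
              nuEdge N x / (a - x))
            + (N : ℝ) ^ ((1 : ℝ) / 3) - (M : ℝ) ^ ((1 : ℝ) / 3)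
            - ∫ x in Set.Ioi ((M : ℝ) ^ ((2 : ℝ) / 3) * (γM ⌊K + K ^ δc⌋₊ + 2)),
              nuEdge M x / (a - x)| ≤
          C * (N : ℝ) ^ (-(1 : ℝ) / 3) * Real.log N * K := by
  refine ⟨1700, by norm_num, fun N M hN hNM hMN γN γM hγN hγM K hK a ha1 ha2 => ?_⟩
  obtain ⟨hm1, hmk, hj1, hjk, hkN, hk5, hk2K, hK1, hK3⟩ :=
    edge_index_bounds hω1 hω2 hδ1 (by linarith) hN hK
  generalize ⌊K + K ^ δc⌋₊ = k at *
  generalize ⌊K + K ^ δc - K ^ (δc / 2)⌋₊ = j at *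
  generalize ⌊K⌋₊ = m at *
  have hN0 : 0 < N := by omega
  have hM0 : 0 < M := by omega
  have hNr : (0 : ℝ) < N := by exact_mod_cast hN0
  have hMr : (0 : ℝ) < M := by exact_mod_cast hM0
  have hNMr : (N : ℝ) ≤ M := by exact_mod_cast hNM
  have hMNr : (M : ℝ) ≤ 10 * N := by exact_mod_cast hMN
  have inv_sqrt : ∀ n : ℕ, 0 < n →
      (n : ℝ) ^ ((1 : ℝ) / 3) = 1 / √((n : ℝ) ^ (-(2 : ℝ) / 3)) := fun n hn => by
    rw [sqrt_rpow_neg_two_thirds (by exact_mod_cast hn), neg_div, Real.rpow_neg (by positivity),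
      one_div (_⁻¹), inv_inv]
  simp_rw [nuEdge_eq hN0, nuEdge_eq hM0]
  have qN := fun i h1 h2 => integral_edgeDensity_quantile hN0 (hγN i h1 h2)
  have qM := integral_edgeDensity_quantile hM0 (hγM k (by omega) (by omega))
  have qNk := qN k (by omega) hkN
  have qNj := qN j hj1 (by omega)
  have qNm := qN m hm1 (by omega)
  rw [inv_sqrt N hN0, inv_sqrt M hM0, ← sqrt_rpow_neg_two_thirds hNr]
  rw [inv_sqrt N hN0] at hK3
  have hp3 : ((N : ℝ) ^ (-(2 : ℝ) / 3)) ^ 3 * N ^ 2 = 1 := by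
    rw [← Real.rpow_natCast, ← Real.rpow_mul hNr.le, ← Real.rpow_natCast (N : ℝ) 2,
      ← Real.rpow_add hNr]
    norm_num
  have hqp : (M : ℝ) ^ (-(2 : ℝ) / 3) ≤ (N : ℝ) ^ (-(2 : ℝ) / 3) :=
    Real.rpow_le_rpow_of_nonpos hNr hNMr (by norm_num)
  have hpq : (N : ℝ) ^ (-(2 : ℝ) / 3) ≤ 5 * (M : ℝ) ^ (-(2 : ℝ) / 3) := by
    have h10 : (10 : ℝ) ^ ((2 : ℝ) / 3) ≤ 5 := by
      refine le_of_pow_le_pow_left₀ (n := 3) (by norm_num) (by norm_num) ?_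
      rw [← Real.rpow_natCast, ← Real.rpow_mul (by norm_num)]
      norm_num
    calc (N : ℝ) ^ (-(2 : ℝ) / 3) = 10 ^ ((2 : ℝ) / 3) * (10 * N : ℝ) ^ (-(2 : ℝ) / 3) := by
          rw [Real.mul_rpow (by norm_num) hNr.le, ← mul_assoc, ← Real.rpow_add (by norm_num)]
          norm_num
      _ ≤ _ := mul_le_mul h10 (Real.rpow_le_rpow_of_nonpos hMr hMNr (by norm_num))
        (by positivity) (by norm_num)
  have hp : 0 < (N : ℝ) ^ (-(2 : ℝ) / 3) := by positivity
  have hq : 0 < (M : ℝ) ^ (-(2 : ℝ) / 3) := by positivity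
  have hlog : 1 ≤ 2 * Real.log N := by
    have : Real.log 2 ≤ Real.log N := Real.log_le_log (by norm_num) (by exact_mod_cast hN)
    linarith [Real.log_two_gt_d9]
  generalize (N : ℝ) ^ (-(2 : ℝ) / 3) = p at *
  generalize (M : ℝ) ^ (-(2 : ℝ) / 3) = q at *
  generalize (N : ℝ) ^ ((2 : ℝ) / 3) * (γN k + 2) = L at *
  generalize (N : ℝ) ^ ((2 : ℝ) / 3) * (γN j + 2) = A at *
  generalize (N : ℝ) ^ ((2 : ℝ) / 3) * (γN m + 2) = B at *
  generalize (M : ℝ) ^ ((2 : ℝ) / 3) * (γM k + 2) = L' at *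
  have hk2 : (2 : ℝ) ≤ k := by exact_mod_cast (by omega : 2 ≤ k)
  have hpk : p ^ 3 * (k : ℝ) ^ 5 ≤ 8 := by
    have : (k : ℝ) ^ 5 ≤ 8 * N ^ 2 := by exact_mod_cast hk5
    calc _ ≤ p ^ 3 * (8 * (N : ℝ) ^ 2) := by gcongr
      _ = 8 := by linear_combination 8 * hp3
  rw [← integral_edgeDensity_min hq] at qM
  rw [← integral_edgeDensity_min hp] at qNk
  have hL'0 : 0 < min L' (4 / q) := by
    by_contra! h0
    rw [integral_edgeDensity_of_nonpos q h0] at qM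
    linarith
  have hjk' : (j : ℝ) + 1 ≤ k := by exact_mod_cast hjk
  have hmk' : (m : ℝ) + 1 ≤ k := by exact_mod_cast hmk
  have hA := edge_quantile_gap hp hq.le hk2 hpk hL'0 qM (A := A) (by linarith)
  have hB := edge_quantile_gap hp hq.le hk2 hpk hL'0 qM (A := B) (by linarith)
  rw [setIntegral_Ioi_edgeDensity hp (show 4 / p ≤ 4 / q by gcongr),
    setIntegral_Ioi_edgeDensity hq le_rfl]
  refine (edge_integral_comparison hq hqp hpq (by linarith) hL'0 (min_le_right _ _)
    (min_le_right _ _) qNk qM (abs_le.2 ⟨by linarith, by linarith⟩)).trans ?_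
  have hsp := Real.sqrt_pos.2 hp
  rw [le_div_iff₀ hsp] at hK3
  have hpp := Real.mul_self_sqrt hp.le
  calc _ ≤ 15 * (2 * K) * √p + 202 * (2 * K) ^ 2 * p := by gcongr
    _ = 30 * (K * √p) + 808 * (K * √p) * (K * √p) := by
      linear_combination (-808 * K ^ 2) * hpp
    _ ≤ 30 * (K * √p) + 808 * (K * √p) * 1 := by gcongr
    _ ≤ 850 * (K * √p) * 1 := by
      have : 0 < K * √p := by positivity
      linarith
    _ ≤ 850 * (K * √p) * (2 * Real.log N) := by gcongr
    _ = _ := by ring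
end
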